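/- arXiv:1809.04743 — 3 statements merged into one kernel-verified Lean document; each statement's English description precedes it below -/
import Mathlib

section
/- For 0 < ρ < 1 and μ ∈ ℂ, there exist positive constants a and L such that |φ(ρ,μ;-r)| ≤ L e^{-a r^q} for all r ≥ 0, where q = 1/(1+ρ). -/
open MeasureTheory Set

/-- The Wright function `φ(ρ, μ; z) = ∑ z^k/(k! Γ(ρk+μ))`. -/
noncomputable def wright (ρ : ℝ) (μ : ℂ) (z : ℂ) : ℂ :=
  ∑' k : ℕ, z ^ k / ((k.factorial : ℂ) * Complex.Gamma ((ρ : ℂ) * k + μ))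

/-- Bessel function of the first kind of real order `ν` at a real argument. -/
noncomputable def besselJ (ν : ℝ) (x : ℝ) : ℝ :=
  (x / 2) ^ ν * ∑' k : ℕ, (-1 : ℝ) ^ k * (x / 2) ^ (2 * k) /
    ((k.factorial : ℝ) * Real.Gamma (ν + k + 1))

/-- Mittag-Leffler function. -/
noncomputable def mittagLeffler (a m : ℝ) (z : ℂ) : ℂ :=
  ∑' k : ℕ, z ^ k / Complex.Gamma ((a : ℂ) * k + m)

variable {X : Type*} [NormedAddCommGroup X] [NormedSpace ℂ X]

/-- `R` is the (bounded, everywhere-defined) resolvent `(z - A)⁻¹` of the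
(possibly unbounded) linear operator `A`; i.e. `z ∈ ρ(A)`. -/
structure IsResolventOf (A : X →ₗ.[ℂ] X) (z : ℂ) (R : X →L[ℂ] X) : Prop where
  mem : ∀ x : X, R x ∈ A.domain
  right : ∀ x : X, z • R x - A ⟨R x, mem x⟩ = x
  left : ∀ y : A.domain, R (z • (y : X) - A y) = y

/-- The open sector of half-angle `θ` around the positive real axis. -/
def sect (θ : ℝ) : Set ℂ := {z : ℂ | z ≠ 0 ∧ |Complex.arg z| < θ}

/-- `A` is sectorial of angle `ω`: the spectrum lies in the closed sector of angle `ω`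
(resolvents exist outside) and `‖z(z-A)⁻¹‖` is uniformly bounded outside each bigger
closed sector. -/
def IsSectorial (A : X →ₗ.[ℂ] X) (ω : ℝ) : Prop :=
  (∀ z ∈ (closure (sect ω))ᶜ, ∃ R : X →L[ℂ] X, IsResolventOf A z R) ∧
  ∀ ω' ∈ Set.Ioo ω Real.pi, ∃ M : ℝ,
    ∀ z ∈ (closure (sect ω'))ᶜ, ∀ R : X →L[ℂ] X, IsResolventOf A z R → ‖z‖ * ‖R‖ ≤ M

/-- `B = A⁻¹` as an unbounded operator. -/
def IsInverseOf (B A : X →ₗ.[ℂ] X) : Prop :=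
  (∀ x : A.domain, ∃ h : A x ∈ B.domain, B ⟨A x, h⟩ = (x : X)) ∧
  (∀ y : B.domain, ∃ h : B y ∈ A.domain, A ⟨B y, h⟩ = (y : X))

/-- Riemann–Liouville fractional integral of order `μ > 0`. -/
noncomputable def fracInt (μ : ℝ) (f : ℝ → X) (t : ℝ) : X :=
  ∫ s in Set.Ioo 0 t, ((t - s) ^ (μ - 1) / Real.Gamma μ) • f s

/-- `S` is a `β`-times integrated `α`-resolvent operator function generated by `A`,
with exponential bound `M e^{ω t}`. -/
structure IsROF (A : X →ₗ.[ℂ] X) (α β : ℝ) (S : ℝ → X →L[ℂ] X) (ω M : ℝ) : Prop where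
  cont : ∀ x : X, ContinuousOn (fun t : ℝ => S t x) (Set.Ici 0)
  bound : ∀ t : ℝ, 0 ≤ t → ‖S t‖ ≤ M * Real.exp (ω * t)
  laplace : ∀ l : ℝ, ω < l → ∃ R : X →L[ℂ] X,
    IsResolventOf A ((l ^ α : ℝ) : ℂ) R ∧
    ∀ x : X, ((l ^ (α - β - 1) : ℝ) : ℂ) • R x =
      ∫ t in Set.Ioi (0 : ℝ), Real.exp (-(l * t)) • S t x

/-- `S` is a tempered `β`-times integrated `α`-resolvent operator function generated
by `A`: `‖S t‖ ≤ M t^β` and the Laplace-transform identity holds for all `λ > 0`. -/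
structure IsTemperedROF (A : X →ₗ.[ℂ] X) (α β : ℝ) (S : ℝ → X →L[ℂ] X) (M : ℝ) : Prop where
  cont : ∀ x : X, ContinuousOn (fun t : ℝ => S t x) (Set.Ici 0)
  bound : ∀ t : ℝ, 0 ≤ t → ‖S t‖ ≤ M * t ^ β
  laplace : ∀ l : ℝ, 0 < l → ∃ R : X →L[ℂ] X,
    IsResolventOf A ((l ^ α : ℝ) : ℂ) R ∧
    ∀ x : X, ((l ^ (α - β - 1) : ℝ) : ℂ) • R x =
      ∫ t in Set.Ioi (0 : ℝ), Real.exp (-(l * t)) • S t x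

open Filter Topology

/-! ### Double exponential majorants -/

lemma tendsto_mul_sub_mul_exp_atBot (p : ℝ) {κ : ℝ} (hκ : 0 < κ) :
    Tendsto (fun x : ℝ => p * x - κ * Real.exp x) atTop atBot := by
  have h1 : Tendsto (fun x : ℝ => Real.exp x * (p * (x / Real.exp x) - κ)) atTop atBot := by
    apply Tendsto.atTop_mul_neg (C := -κ) (by linarith) Real.tendsto_exp_atTop
    have h2 : Tendsto (fun x : ℝ => x / Real.exp x) atTop (𝓝 0) := by
      simpa using Real.tendsto_pow_mul_exp_neg_atTop_nhds_zero 1 |>.congr (fun x => by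
        simp [Real.exp_neg, div_eq_mul_inv])
    simpa using (h2.const_mul p).sub_const κ
  refine h1.congr fun x => ?_
  have := Real.exp_pos x
  field_simp

lemma tendsto_exp_mul_sub_mul_exp (p : ℝ) {κ : ℝ} (hκ : 0 < κ) :
    Tendsto (fun x : ℝ => Real.exp (p * x - κ * Real.exp x)) atTop (𝓝 0) :=
  Real.tendsto_exp_atBot.comp (tendsto_mul_sub_mul_exp_atBot p hκ)

lemma integrableOn_Ioi_exp_mul_sub_mul_exp (p : ℝ) {κ : ℝ} (hκ : 0 < κ) (c : ℝ) :
    IntegrableOn (fun x : ℝ => Real.exp (p * x - κ * Real.exp x)) (Ioi c) := by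
  apply integrable_of_isBigO_exp_neg one_pos (by fun_prop)
  apply Asymptotics.IsLittleO.isBigO
  refine (Asymptotics.isLittleO_iff_tendsto (fun x hx => absurd hx (Real.exp_ne_zero _))).2 ?_
  refine (tendsto_exp_mul_sub_mul_exp (p + 1) hκ).congr fun x => ?_
  rw [← Real.exp_sub]
  ring_nf

lemma integrable_exp_mul_sub_mul_exp {p κ : ℝ} (hp : 0 < p) (hκ : 0 < κ) :
    Integrable (fun x : ℝ => Real.exp (p * x - κ * Real.exp x)) := by
  rw [← integrableOn_univ, ← Iic_union_Ioi (a := (0 : ℝ))]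
  refine IntegrableOn.union ?_ (integrableOn_Ioi_exp_mul_sub_mul_exp p hκ 0)
  refine Integrable.mono' (integrableOn_exp_mul_Iic hp 0)
    (by fun_prop) (Eventually.of_forall fun x => ?_)
  rw [Real.norm_of_nonneg (Real.exp_pos _).le]
  apply Real.exp_le_exp.2
  have := mul_pos hκ (Real.exp_pos x)
  linarith

lemma mul_le_mul_exp_add (p : ℝ) {κ : ℝ} (hκ : 0 < κ) :
    ∃ C : ℝ, ∀ x : ℝ, 0 ≤ x → p * x ≤ κ * Real.exp x + C := by
  have hP : 0 < |p| + 1 := by positivity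
  refine ⟨-((|p| + 1) * (Real.log (κ / (|p| + 1)) + 1)), fun x hx => ?_⟩
  have h := Real.add_one_le_exp (x + Real.log (κ / (|p| + 1)))
  rw [Real.exp_add, Real.exp_log (by positivity)] at h
  have h2 := mul_le_mul_of_nonneg_left h hP.le
  have h3 : (|p| + 1) * (Real.exp x * (κ / (|p| + 1))) = κ * Real.exp x := by field_simp
  have h4 : p * x ≤ (|p| + 1) * x := by
    apply mul_le_mul_of_nonneg_right _ hx
    linarith [le_abs_self p]
  linarith

/-! ### Hankel contour in the logarithmic coordinate -/

/-- The integral of `F` along the contour running from `+∞ - iθ` to `c - iθ`, then to `c + iθ`,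
then to `+∞ + iθ`. -/
noncomputable def hankelIntegral (θ : ℝ) (F : ℂ → ℂ) (c : ℝ) : ℂ :=
  (∫ x in Ioi c, F ((x : ℂ) + (θ : ℂ) * Complex.I))
    - (∫ x in Ioi c, F ((x : ℂ) + ((-θ : ℝ) : ℂ) * Complex.I))
    + Complex.I * ∫ y in (-θ)..θ, F ((c : ℂ) + (y : ℂ) * Complex.I)

lemma hankelIntegral_eq_of_le {θ : ℝ} {F : ℂ → ℂ} (hF : Differentiable ℂ F) {c d : ℝ}
    (hcd : c ≤ d)
    (hu : IntegrableOn (fun x : ℝ => F ((x : ℂ) + (θ : ℂ) * Complex.I)) (Ioi c))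
    (hl : IntegrableOn (fun x : ℝ => F ((x : ℂ) + ((-θ : ℝ) : ℂ) * Complex.I)) (Ioi c)) :
    hankelIntegral θ F c = hankelIntegral θ F d := by
  have h := Complex.integral_boundary_rect_eq_zero_of_differentiableOn F
    ((c : ℂ) + ((-θ : ℝ) : ℂ) * Complex.I) ((d : ℂ) + (θ : ℂ) * Complex.I) hF.differentiableOn
  simp only [Complex.add_re, Complex.add_im, Complex.ofReal_re, Complex.ofReal_im,
    Complex.mul_re, Complex.mul_im, Complex.I_re, Complex.I_im, mul_zero, mul_one,
    sub_zero, add_zero, zero_add, smul_eq_mul] at h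
  have h1 := intervalIntegral.integral_Ioi_sub_Ioi hu hcd
  have h2 := intervalIntegral.integral_Ioi_sub_Ioi hl hcd
  rw [← h1, ← h2] at h
  unfold hankelIntegral
  linear_combination -h

lemma integral_ray_sub_integral_ray {F : ℂ → ℂ} (hF : Differentiable ℂ F) {θ₁ θ₂ c : ℝ}
    {g : ℝ → ℝ} (hg : Tendsto g atTop (𝓝 0))
    (hFg : ∀ x : ℝ, ∀ y ∈ uIoc θ₁ θ₂, ‖F ((x : ℂ) + (y : ℂ) * Complex.I)‖ ≤ g x)
    (h₁ : IntegrableOn (fun x : ℝ => F ((x : ℂ) + (θ₁ : ℂ) * Complex.I)) (Ioi c))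
    (h₂ : IntegrableOn (fun x : ℝ => F ((x : ℂ) + (θ₂ : ℂ) * Complex.I)) (Ioi c)) :
    (∫ x in Ioi c, F ((x : ℂ) + (θ₁ : ℂ) * Complex.I))
      - (∫ x in Ioi c, F ((x : ℂ) + (θ₂ : ℂ) * Complex.I))
      = Complex.I * ∫ y in θ₁..θ₂, F ((c : ℂ) + (y : ℂ) * Complex.I) := by
  have t₁ := intervalIntegral_tendsto_integral_Ioi c h₁ tendsto_id
  have t₂ := intervalIntegral_tendsto_integral_Ioi c h₂ tendsto_id
  have t₃ : Tendsto (fun R : ℝ => ∫ y in θ₁..θ₂, F ((R : ℂ) + (y : ℂ) * Complex.I)) atTop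
      (𝓝 0) := by
    refine squeeze_zero_norm (a := fun R => g R * |θ₂ - θ₁|) (fun R =>
      intervalIntegral.norm_integral_le_of_norm_le_const (hFg R)) ?_
    simpa using hg.mul_const |θ₂ - θ₁|
  have t := (t₁.sub t₂).add (t₃.const_mul Complex.I)
  rw [mul_zero, add_zero] at t
  refine tendsto_nhds_unique t (tendsto_const_nhds.congr fun R => ?_)
  have h := Complex.integral_boundary_rect_eq_zero_of_differentiableOn F
    ((c : ℂ) + (θ₁ : ℂ) * Complex.I) ((R : ℂ) + (θ₂ : ℂ) * Complex.I) hF.differentiableOn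
  simp only [Complex.add_re, Complex.add_im, Complex.ofReal_re, Complex.ofReal_im,
    Complex.mul_re, Complex.mul_im, Complex.I_re, Complex.I_im, mul_zero, mul_one,
    sub_zero, add_zero, zero_add, smul_eq_mul] at h
  simp only [id]
  linear_combination -h

/-- The integrand of Hankel's formula for `1 / Γ(w)` in the logarithmic coordinate. -/
noncomputable def hankelKernel (w v : ℂ) : ℂ := Complex.exp (Complex.exp v + (1 - w) * v)

lemma differentiable_hankelKernel (w : ℂ) : Differentiable ℂ (hankelKernel w) := by
  unfold hankelKernel
  fun_prop

lemma norm_hankelKernel (w : ℂ) (x y : ℝ) :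
    ‖hankelKernel w ((x : ℂ) + (y : ℂ) * Complex.I)‖
      = Real.exp (Real.exp x * Real.cos y + ((1 - w.re) * x + w.im * y)) := by
  simp [hankelKernel, Complex.norm_exp, Complex.exp_re]

lemma norm_hankelKernel_le (w : ℂ) {κ y : ℝ} (hy : |y| ≤ Real.pi) (hc : Real.cos y ≤ -κ)
    (x : ℝ) : ‖hankelKernel w ((x : ℂ) + (y : ℂ) * Complex.I)‖
      ≤ Real.exp (|w.im| * Real.pi) * Real.exp ((1 - w.re) * x - κ * Real.exp x) := by
  rw [norm_hankelKernel, ← Real.exp_add]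
  apply Real.exp_le_exp.2
  have h1 := mul_le_mul_of_nonneg_left hc (Real.exp_pos x).le
  have h2 : w.im * y ≤ |w.im| * Real.pi := by
    calc w.im * y ≤ |w.im * y| := le_abs_self _
      _ = |w.im| * |y| := abs_mul _ _
      _ ≤ _ := by gcongr
  linarith

lemma integrableOn_hankelKernel (w : ℂ) {κ y : ℝ} (hκ : 0 < κ) (hy : |y| ≤ Real.pi)
    (hc : Real.cos y ≤ -κ) (c : ℝ) :
    IntegrableOn (fun x : ℝ => hankelKernel w ((x : ℂ) + (y : ℂ) * Complex.I)) (Ioi c) := by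
  refine Integrable.mono' ((integrableOn_Ioi_exp_mul_sub_mul_exp (1 - w.re) hκ c).const_mul
    (Real.exp (|w.im| * Real.pi))) ?_ (Eventually.of_forall (norm_hankelKernel_le w hy hc))
  have := (differentiable_hankelKernel w).continuous
  exact Continuous.aestronglyMeasurable (by fun_prop)

lemma hankelIntegral_hankelKernel_eq_pi (w : ℂ) {θ : ℝ} (h1 : Real.pi / 2 < θ)
    (h2 : θ ≤ Real.pi) (c : ℝ) :
    hankelIntegral θ (hankelKernel w) c = hankelIntegral Real.pi (hankelKernel w) c := by
  have hpi := Real.pi_pos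
  have hκ : 0 < -Real.cos θ := by
    linarith [Real.cos_neg_of_pi_div_two_lt_of_lt h1 (by linarith)]
  have hcos : ∀ y, θ ≤ |y| → |y| ≤ Real.pi → Real.cos y ≤ -(-Real.cos θ) := by
    intro y hy hy'
    rw [neg_neg, ← Real.cos_abs y]
    exact Real.cos_le_cos_of_nonneg_of_le_pi (by linarith) hy' hy
  have hg : Tendsto (fun x => Real.exp (|w.im| * Real.pi) *
      Real.exp ((1 - w.re) * x - (-Real.cos θ) * Real.exp x)) atTop (𝓝 0) := by
    simpa using (tendsto_exp_mul_sub_mul_exp (1 - w.re) hκ).const_mul _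
  have habsθ : |θ| = θ := abs_of_pos (by linarith)
  have habsπ : |Real.pi| = Real.pi := abs_of_pos hpi
  have hint : ∀ y, θ ≤ |y| → |y| ≤ Real.pi → IntegrableOn
      (fun x : ℝ => hankelKernel w ((x : ℂ) + (y : ℂ) * Complex.I)) (Ioi c) :=
    fun y hy hy' => integrableOn_hankelKernel w hκ hy' (hcos y hy hy') c
  have hd := differentiable_hankelKernel w
  have A := integral_ray_sub_integral_ray hd (θ₁ := θ) (θ₂ := Real.pi) (c := c) hg
    (fun x y hy => by
      rw [uIoc_of_le h2] at hy
      have : |y| = y := abs_of_pos (by linarith [hy.1])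
      exact norm_hankelKernel_le w (by linarith [hy.2]) (hcos y (by linarith [hy.1])
        (by linarith [hy.2])) x)
    (hint _ (by linarith) (by linarith)) (hint _ (by linarith) (by linarith))
  have B := integral_ray_sub_integral_ray hd (θ₁ := -Real.pi) (θ₂ := -θ) (c := c) hg
    (fun x y hy => by
      rw [uIoc_of_le (by linarith)] at hy
      have : |y| = -y := abs_of_neg (by linarith [hy.2])
      exact norm_hankelKernel_le w (by linarith [hy.1]) (hcos y (by linarith [hy.2])
        (by linarith [hy.1])) x)
    (hint _ (by rw [abs_neg]; linarith) (by rw [abs_neg]; linarith))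
    (hint _ (by rw [abs_neg]; linarith) (by rw [abs_neg]; linarith))
  have hii : ∀ a b : ℝ, IntervalIntegrable
      (fun y : ℝ => hankelKernel w ((c : ℂ) + (y : ℂ) * Complex.I)) volume a b := fun a b => by
    have := hd.continuous
    exact Continuous.intervalIntegrable (by fun_prop) a b
  have e1 := intervalIntegral.integral_add_adjacent_intervals (hii (-Real.pi) (-θ)) (hii (-θ) θ)
  have e2 := intervalIntegral.integral_add_adjacent_intervals (hii (-Real.pi) θ)
    (hii θ Real.pi)
  unfold hankelIntegral
  rw [← e2, ← e1]
  linear_combination A + B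

/-! ### Hankel's formula for the reciprocal Gamma function -/

lemma integral_cexp_neg_exp_add_mul {p : ℂ} (hp : 0 < p.re) :
    ∫ x : ℝ, Complex.exp (-(Real.exp x : ℂ) + p * x) = Complex.Gamma p := by
  rw [Complex.Gamma_eq_integral hp, Complex.GammaIntegral, ← Real.range_exp, ← image_univ,
    integral_image_eq_integral_abs_deriv_smul MeasurableSet.univ
      (fun x _ => (Real.hasDerivAt_exp x).hasDerivWithinAt) Real.exp_injective.injOn,
    Measure.restrict_univ]
  congr 1 with x
  rw [abs_of_pos (Real.exp_pos x), Complex.cpow_def_of_ne_zero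
    (by exact_mod_cast (Real.exp_pos x).ne'), ← Complex.ofReal_log (Real.exp_pos x).le,
    Real.log_exp, Complex.real_smul, Complex.ofReal_exp (-_), Complex.ofReal_neg]
  nth_rewrite 2 [Complex.ofReal_exp]
  rw [← Complex.exp_add, ← Complex.exp_add]
  congr 1
  ring

lemma cos_le_neg_one_of_abs_eq_pi {y : ℝ} (hy : |y| = Real.pi) : Real.cos y ≤ -1 := by
  rw [← Real.cos_abs, hy, Real.cos_pi]

lemma hankelIntegral_pi_hankelKernel_of_re_lt_one {w : ℂ} (hw : w.re < 1) (c : ℝ) :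
    hankelIntegral Real.pi (hankelKernel w) c = 2 * Real.pi * Complex.I / Complex.Gamma w := by
  have hpi := Real.pi_pos
  have habsπ : |Real.pi| = Real.pi := abs_of_pos hpi
  have habsπ' : |-Real.pi| = Real.pi := by rw [abs_neg, habsπ]
  have hd := differentiable_hankelKernel w
  have hcont := hd.continuous
  have hp : 0 < (1 - w).re := by simpa using hw
  have hp' : 0 < 1 - w.re := by linarith
  have hint : ∀ y : ℝ, |y| = Real.pi → Integrable
      (fun x : ℝ => hankelKernel w ((x : ℂ) + (y : ℂ) * Complex.I)) := fun y hy => by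
    refine Integrable.mono' ((integrable_exp_mul_sub_mul_exp hp' one_pos).const_mul
      (Real.exp (|w.im| * Real.pi))) ?_ (Eventually.of_forall
        (norm_hankelKernel_le w hy.le (cos_le_neg_one_of_abs_eq_pi hy)))
    exact Continuous.aestronglyMeasurable (by fun_prop)
  have hval : ∀ y : ℝ, Complex.exp ((y : ℂ) * Complex.I) = -1 →
      ∫ x : ℝ, hankelKernel w ((x : ℂ) + (y : ℂ) * Complex.I)
        = Complex.exp ((1 - w) * (y * Complex.I)) * Complex.Gamma (1 - w) := fun y hy => by
    rw [← integral_cexp_neg_exp_add_mul hp, ← integral_const_mul]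
    congr 1 with x
    rw [hankelKernel, Complex.exp_add (x : ℂ), hy, ← Complex.exp_add, Complex.ofReal_exp]
    congr 1
    ring
  have harc : Tendsto (fun c : ℝ => ∫ y in (-Real.pi)..Real.pi,
      hankelKernel w ((c : ℂ) + (y : ℂ) * Complex.I)) atBot (𝓝 0) := by
    refine squeeze_zero_norm' (a := fun c => Real.exp (1 + |w.im| * Real.pi) *
      Real.exp ((1 - w.re) * c) * |Real.pi - -Real.pi|) ?_ ?_
    · filter_upwards [eventually_le_atBot 0] with c hc
      refine intervalIntegral.norm_integral_le_of_norm_le_const fun y hy => ?_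
      rw [uIoc_of_le (by linarith)] at hy
      rw [norm_hankelKernel, ← Real.exp_add]
      apply Real.exp_le_exp.2
      have h1 : Real.exp c * Real.cos y ≤ 1 := by
        have := Real.exp_le_one_iff.2 hc
        have := Real.exp_pos c
        nlinarith [Real.cos_le_one y]
      have h2 : w.im * y ≤ |w.im| * Real.pi := by
        calc w.im * y ≤ |w.im * y| := le_abs_self _
          _ = |w.im| * |y| := abs_mul _ _
          _ ≤ _ := by gcongr; exact abs_le.2 ⟨hy.1.le, hy.2⟩
      linarith
    · have : Tendsto (fun c : ℝ => Real.exp ((1 - w.re) * c)) atBot (𝓝 0) :=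
        Real.tendsto_exp_atBot.comp (tendsto_id.const_mul_atBot hp')
      simpa using (this.const_mul (Real.exp (1 + |w.im| * Real.pi))).mul_const
        |Real.pi - -Real.pi|
  have hlim : Tendsto (fun c => hankelIntegral Real.pi (hankelKernel w) c) atBot (𝓝
      ((∫ x : ℝ, hankelKernel w ((x : ℂ) + (Real.pi : ℂ) * Complex.I))
        - (∫ x : ℝ, hankelKernel w ((x : ℂ) + ((-Real.pi : ℝ) : ℂ) * Complex.I))
        + Complex.I * 0)) :=
    (((aecover_Ioi tendsto_id).integral_tendsto_of_countably_generated (hint _ habsπ)).sub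
      ((aecover_Ioi tendsto_id).integral_tendsto_of_countably_generated (hint _ habsπ'))).add
      (harc.const_mul Complex.I)
  have hconst : Tendsto (fun c => hankelIntegral Real.pi (hankelKernel w) c) atBot (𝓝
      (hankelIntegral Real.pi (hankelKernel w) c)) := by
    refine tendsto_const_nhds.congr' ?_
    filter_upwards [eventually_le_atBot c] with d hd'
    exact (hankelIntegral_eq_of_le hd hd' (hint _ habsπ).integrableOn
      (hint _ habsπ').integrableOn).symm
  rw [tendsto_nhds_unique hconst hlim, hval _ Complex.exp_pi_mul_I, hval _ (by
    rw [Complex.ofReal_neg, neg_mul, Complex.exp_neg, Complex.exp_pi_mul_I]; norm_num)]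
  have hsin : Complex.exp ((1 - w) * (Real.pi * Complex.I))
      - Complex.exp ((1 - w) * (((-Real.pi : ℝ) : ℂ) * Complex.I))
      = 2 * Complex.I * Complex.sin (Real.pi * w) := by
    have : Complex.sin (Real.pi * w) = Complex.sin (Real.pi * (1 - w)) := by
      rw [mul_sub, mul_one, Complex.sin_pi_sub]
    rw [this, Complex.sin, Complex.ofReal_neg]
    have h1 : (1 - w) * (Real.pi * Complex.I) = Real.pi * (1 - w) * Complex.I := by ring
    have h2 : (1 - w) * (-(Real.pi : ℂ) * Complex.I) = -(Real.pi * (1 - w)) * Complex.I := by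
      ring
    rw [h1, h2]
    linear_combination (-(Complex.exp (-(Real.pi * (1 - w)) * Complex.I)
      - Complex.exp (Real.pi * (1 - w) * Complex.I))) * Complex.I_mul_I
  have hrefl := Complex.Gamma_mul_Gamma_one_sub w
  have hne : Complex.Gamma (1 - w) ≠ 0 := Complex.Gamma_ne_zero_of_re_pos hp
  rw [mul_zero, add_zero, ← sub_mul, hsin]
  by_cases hs : Complex.sin (Real.pi * w) = 0
  · rw [hs, div_zero] at hrefl
    have : Complex.Gamma w = 0 := (mul_eq_zero.1 hrefl).resolve_right hne
    simp [hs, this]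
  · have hG : Complex.Gamma w ≠ 0 := by
      intro h0
      rw [h0, zero_mul] at hrefl
      exact div_ne_zero (by exact_mod_cast hpi.ne') hs hrefl.symm
    rw [eq_div_iff hs] at hrefl
    rw [eq_div_iff hG]
    linear_combination 2 * Complex.I * hrefl

lemma hankelIntegral_pi_hankelKernel_eq_mul (w : ℂ) :
    hankelIntegral Real.pi (hankelKernel w) 0
      = w * hankelIntegral Real.pi (hankelKernel (w + 1)) 0 := by
  have hpi := Real.pi_pos
  have habsπ : |Real.pi| = Real.pi := abs_of_pos hpi
  have habsπ' : |-Real.pi| = Real.pi := by rw [abs_neg, habsπ]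
  have hder : ∀ v : ℂ, HasDerivAt (hankelKernel (w + 1))
      (hankelKernel w v - w * hankelKernel (w + 1) v) v := fun v => by
    have h : HasDerivAt (fun v : ℂ => Complex.exp v + (1 - (w + 1)) * v)
        (Complex.exp v + (1 - (w + 1)) * 1) v :=
      (Complex.hasDerivAt_exp v).add ((hasDerivAt_id v).const_mul _)
    convert! h.cexp using 1
    have : hankelKernel w v = Complex.exp v * hankelKernel (w + 1) v := by
      rw [hankelKernel, hankelKernel, ← Complex.exp_add]
      congr 1
      ring
    rw [this, hankelKernel]
    ring
  have hint : ∀ (w : ℂ) (y : ℝ), |y| = Real.pi → IntegrableOn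
      (fun x : ℝ => hankelKernel w ((x : ℂ) + (y : ℂ) * Complex.I)) (Ioi 0) := fun w y hy =>
    integrableOn_hankelKernel w one_pos hy.le (cos_le_neg_one_of_abs_eq_pi hy) 0
  have hray : ∀ y : ℝ, |y| = Real.pi →
      (∫ x in Ioi (0 : ℝ), hankelKernel w ((x : ℂ) + (y : ℂ) * Complex.I))
        - w * (∫ x in Ioi (0 : ℝ), hankelKernel (w + 1) ((x : ℂ) + (y : ℂ) * Complex.I))
        = -hankelKernel (w + 1) (y * Complex.I) := fun y hy => by
    have hlim : Tendsto (fun x : ℝ => hankelKernel (w + 1) ((x : ℂ) + (y : ℂ) * Complex.I))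
        atTop (𝓝 0) := by
      refine squeeze_zero_norm (norm_hankelKernel_le (w + 1) hy.le
        (cos_le_neg_one_of_abs_eq_pi hy)) ?_
      simpa using (tendsto_exp_mul_sub_mul_exp (1 - (w + 1).re) one_pos).const_mul
        (Real.exp (|(w + 1).im| * Real.pi))
    have h := integral_Ioi_of_hasDerivAt_of_tendsto' (a := (0 : ℝ)) (fun x _ =>
      ((hder ((x : ℂ) + (y : ℂ) * Complex.I)).comp_add_const (x : ℂ) _).comp_ofReal)
      ((hint w y hy).sub ((hint (w + 1) y hy).const_mul w)) hlim
    rw [← integral_const_mul, ← integral_sub (hint w y hy) ((hint (w + 1) y hy).const_mul w), h]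
    simp
  have harc : (∫ y in (-Real.pi)..Real.pi, hankelKernel w (((0 : ℝ) : ℂ) + y * Complex.I))
        - w * (∫ y in (-Real.pi)..Real.pi,
          hankelKernel (w + 1) (((0 : ℝ) : ℂ) + y * Complex.I))
        = -Complex.I * (hankelKernel (w + 1) (Real.pi * Complex.I)
          - hankelKernel (w + 1) ((-Real.pi : ℝ) * Complex.I)) := by
    have hc : ∀ w, Continuous (hankelKernel w) := fun w =>
      (differentiable_hankelKernel w).continuous
    have hii : ∀ w, IntervalIntegrable (fun y : ℝ =>
        hankelKernel w (((0 : ℝ) : ℂ) + y * Complex.I)) volume (-Real.pi) Real.pi := fun w => by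
      have := hc w
      exact Continuous.intervalIntegrable (by fun_prop) _ _
    have hder' : ∀ y : ℝ, HasDerivAt (fun y : ℝ => -Complex.I *
        hankelKernel (w + 1) (((0 : ℝ) : ℂ) + y * Complex.I))
        (hankelKernel w (((0 : ℝ) : ℂ) + y * Complex.I)
          - w * hankelKernel (w + 1) (((0 : ℝ) : ℂ) + y * Complex.I)) y := fun y => by
      have hl : HasDerivAt (fun z : ℂ => ((0 : ℝ) : ℂ) + z * Complex.I) (1 * Complex.I)
          (y : ℂ) := ((hasDerivAt_id (y : ℂ)).mul_const Complex.I).const_add _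
      have := (((hder (((0 : ℝ) : ℂ) + y * Complex.I)).comp (y : ℂ) hl).const_mul
        (-Complex.I)).comp_ofReal
      convert! this using 1
      linear_combination (hankelKernel w (((0 : ℝ) : ℂ) + y * Complex.I)
          - w * hankelKernel (w + 1) (((0 : ℝ) : ℂ) + y * Complex.I)) * Complex.I_mul_I
    have h := intervalIntegral.integral_eq_sub_of_hasDerivAt (fun y _ => hder' y)
      ((hii w).sub ((hii (w + 1)).const_mul w))
    rw [intervalIntegral.integral_sub (hii w) ((hii (w + 1)).const_mul w),
      intervalIntegral.integral_const_mul] at h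
    rw [h]
    simp only [Complex.ofReal_zero, zero_add]
    ring
  unfold hankelIntegral
  linear_combination hray _ habsπ - hray _ habsπ' + Complex.I * harc
    + (hankelKernel (w + 1) ((-Real.pi : ℝ) * Complex.I)
      - hankelKernel (w + 1) (Real.pi * Complex.I)) * Complex.I_mul_I

lemma continuousAt_hankelIntegral_pi_hankelKernel (w₀ : ℂ) :
    ContinuousAt (fun w => hankelIntegral Real.pi (hankelKernel w) 0) w₀ := by
  have hpi := Real.pi_pos
  have habsπ : |Real.pi| = Real.pi := abs_of_pos hpi
  have habsπ' : |-Real.pi| = Real.pi := by rw [abs_neg, habsπ]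
  have hc : ∀ w, Continuous (hankelKernel w) := fun w =>
    (differentiable_hankelKernel w).continuous
  have hcw : ∀ v, Continuous (fun w => hankelKernel w v) := fun v => by
    unfold hankelKernel
    fun_prop
  have hball : ∀ᶠ w in 𝓝 w₀, -w.re < -w₀.re + 1 ∧ |w.im| < |w₀.im| + 1 := by
    have h1 : ∀ᶠ w : ℂ in 𝓝 w₀, -w.re < -w₀.re + 1 :=
      (by fun_prop : Continuous fun w : ℂ => -w.re).tendsto w₀ |>.eventually_lt_const
        (by linarith)
    have h2 : ∀ᶠ w : ℂ in 𝓝 w₀, |w.im| < |w₀.im| + 1 :=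
      (by fun_prop : Continuous fun w : ℂ => |w.im|).tendsto w₀ |>.eventually_lt_const
        (by linarith)
    exact h1.and h2
  have hray : ∀ y : ℝ, |y| = Real.pi → ContinuousAt (fun w =>
      ∫ x in Ioi (0 : ℝ), hankelKernel w ((x : ℂ) + (y : ℂ) * Complex.I)) w₀ := fun y hy => by
    refine continuousAt_of_dominated (bound := fun x => Real.exp ((|w₀.im| + 1) * Real.pi) *
      Real.exp ((1 - w₀.re + 1) * x - 1 * Real.exp x)) ?_ ?_
      ((integrableOn_Ioi_exp_mul_sub_mul_exp _ one_pos 0).const_mul _) ?_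
    · refine Eventually.of_forall fun w => ?_
      have := hc w
      exact Continuous.aestronglyMeasurable (by fun_prop)
    · filter_upwards [hball] with w hw
      filter_upwards [ae_restrict_mem measurableSet_Ioi] with x hx
      refine (norm_hankelKernel_le w hy.le (cos_le_neg_one_of_abs_eq_pi hy) x).trans ?_
      have hx' : 0 ≤ x := le_of_lt hx
      gcongr
      · exact hw.2.le
      · linarith [hw.1]
    · exact Eventually.of_forall fun x => (hcw _).continuousAt
  have harc : ContinuousAt (fun w => ∫ y in (-Real.pi)..Real.pi,
      hankelKernel w (((0 : ℝ) : ℂ) + y * Complex.I)) w₀ := by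
    refine intervalIntegral.continuousAt_of_dominated_interval
      (bound := fun y => Real.exp (1 + (|w₀.im| + 1) * Real.pi)) ?_ ?_
      intervalIntegrable_const ?_
    · refine Eventually.of_forall fun w => ?_
      have := hc w
      exact Continuous.aestronglyMeasurable (by fun_prop)
    · filter_upwards [hball] with w hw
      refine Eventually.of_forall fun y hy => ?_
      rw [uIoc_of_le (by linarith)] at hy
      rw [norm_hankelKernel]
      apply Real.exp_le_exp.2
      have h2 : w.im * y ≤ (|w₀.im| + 1) * Real.pi := by
        calc w.im * y ≤ |w.im * y| := le_abs_self _
          _ = |w.im| * |y| := abs_mul _ _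
          _ ≤ _ := by
            gcongr
            · exact hw.2.le
            · exact abs_le.2 ⟨hy.1.le, hy.2⟩
      rw [Real.exp_zero]
      linarith [Real.cos_le_one y]
    · exact Eventually.of_forall fun y _ => (hcw _).continuousAt
  exact ((hray _ habsπ).sub (hray _ habsπ')).add (harc.const_mul Complex.I)

theorem hankelIntegral_pi_hankelKernel (w : ℂ) :
    hankelIntegral Real.pi (hankelKernel w) 0 = 2 * Real.pi * Complex.I / Complex.Gamma w := by
  have hone : hankelIntegral Real.pi (hankelKernel 1) 0
      = 2 * Real.pi * Complex.I / Complex.Gamma 1 := by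
    have hl : Tendsto (fun t : ℝ => (t : ℂ)) (𝓝[<] 1) (𝓝 1) :=
      (Complex.continuous_ofReal.tendsto' 1 1 Complex.ofReal_one).mono_left nhdsWithin_le_nhds
    have h1 := (continuousAt_hankelIntegral_pi_hankelKernel 1).tendsto.comp hl
    have h2 := ((Complex.differentiable_one_div_Gamma.continuous.tendsto 1).comp hl).const_mul
      (2 * Real.pi * Complex.I)
    refine tendsto_nhds_unique h1 (h2.congr' ?_)
    filter_upwards [self_mem_nhdsWithin] with t ht
    exact (hankelIntegral_pi_hankelKernel_of_re_lt_one (by simpa using ht) 0).symm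
  have key : ∀ (n : ℕ) (w : ℂ), w.re < n + 1 → hankelIntegral Real.pi (hankelKernel w) 0
      = 2 * Real.pi * Complex.I / Complex.Gamma w := by
    intro n
    induction n with
    | zero =>
      intro w hw
      exact hankelIntegral_pi_hankelKernel_of_re_lt_one (by simpa using hw) 0
    | succ n ih =>
      intro w hw
      by_cases hw1 : w = 1
      · rw [hw1, hone]
      have hne : w - 1 ≠ 0 := sub_ne_zero.2 hw1
      have h := hankelIntegral_pi_hankelKernel_eq_mul (w - 1)
      have hG := Complex.Gamma_add_one (w - 1) hne
      rw [sub_add_cancel] at h hG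
      rw [ih (w - 1) (by push_cast at hw; simp; linarith)] at h
      rw [hG, div_mul_eq_div_div_swap, h, mul_div_cancel_left₀ _ hne]
  obtain ⟨n, hn⟩ := exists_nat_gt w.re
  exact key n w (by linarith)

/-! ### Integral representation and decay of the Wright function -/

lemma hasSum_pow_div_factorial_mul_integral {α : Type*} [MeasurableSpace α] {ν : Measure α}
    {f g : α → ℂ} (hf : Integrable f ν) (hg : AEStronglyMeasurable g ν)
    (hg1 : ∀ᵐ x ∂ν, ‖g x‖ ≤ 1) (z : ℂ) :
    HasSum (fun k : ℕ => z ^ k / (k.factorial : ℂ) * ∫ x, f x * g x ^ k ∂ν)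
      (∫ x, f x * Complex.exp (z * g x) ∂ν) := by
  have hmul : ∀ k : ℕ, Integrable (fun x => f x * g x ^ k) ν := fun k => by
    refine hf.mono (hf.aestronglyMeasurable.mul (hg.pow k)) ?_
    filter_upwards [hg1] with x hx
    rw [norm_mul, norm_pow]
    exact mul_le_of_le_one_right (norm_nonneg _) (pow_le_one₀ (norm_nonneg _) hx)
  have hint : ∀ k : ℕ, Integrable
      (fun x => z ^ k / (k.factorial : ℂ) * (f x * g x ^ k)) ν := fun k =>
    (hmul k).const_mul _
  have hsum : Summable fun k : ℕ => ∫ x, ‖z ^ k / (k.factorial : ℂ) * (f x * g x ^ k)‖ ∂ν := by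
    refine Summable.of_nonneg_of_le (fun k => integral_nonneg fun x => norm_nonneg _)
      (fun k => ?_) ((Real.summable_pow_div_factorial ‖z‖).mul_right (∫ x, ‖f x‖ ∂ν))
    rw [← integral_const_mul]
    refine integral_mono_ae (hint k).norm (hf.norm.const_mul _) ?_
    filter_upwards [hg1] with x hx
    simp only [norm_mul, norm_div, norm_pow, Complex.norm_natCast]
    gcongr
    exact mul_le_of_le_one_right (norm_nonneg _) (pow_le_one₀ (norm_nonneg _) hx)
  have h := hasSum_integral_of_summable_integral_norm hint hsum
  simp only [integral_const_mul] at h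
  have hexp : ∀ x, f x * Complex.exp (z * g x)
      = ∑' k : ℕ, z ^ k / (k.factorial : ℂ) * (f x * g x ^ k) := fun x => by
    rw [Complex.exp_eq_exp_ℂ, NormedSpace.exp_eq_tsum_div]
    beta_reduce
    rw [← tsum_mul_left]
    congr 1 with k
    rw [mul_pow]
    ring
  simpa only [hexp] using h

/-- The integrand of the contour representation of `φ(ρ, μ; z)` in the logarithmic
coordinate. -/
noncomputable def wrightKernel (ρ : ℝ) (μ z v : ℂ) : ℂ :=
  hankelKernel μ v * Complex.exp (z * Complex.exp (-(ρ * v)))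

lemma differentiable_wrightKernel (ρ : ℝ) (μ z : ℂ) : Differentiable ℂ (wrightKernel ρ μ z) := by
  have := differentiable_hankelKernel μ
  unfold wrightKernel
  fun_prop

lemma hankelKernel_mul_natCast_add (ρ : ℝ) (μ v : ℂ) (k : ℕ) :
    hankelKernel ((ρ : ℂ) * k + μ) v = hankelKernel μ v * Complex.exp (-(ρ * v)) ^ k := by
  rw [hankelKernel, hankelKernel, ← Complex.exp_nat_mul, ← Complex.exp_add]
  congr 1
  ring

lemma wright_eq_hankelIntegral {ρ : ℝ} (hρ : 0 < ρ) (μ z : ℂ) {θ : ℝ} (h1 : Real.pi / 2 < θ)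
    (h2 : θ ≤ Real.pi) :
    wright ρ μ z = hankelIntegral θ (wrightKernel ρ μ z) 0 / (2 * Real.pi * Complex.I) := by
  have hpi := Real.pi_pos
  have hcosθ := Real.cos_neg_of_pi_div_two_lt_of_lt h1 (by linarith)
  have hc := (differentiable_hankelKernel μ).continuous
  have hnorm : ∀ x y : ℝ, 0 ≤ x →
      ‖Complex.exp (-(ρ * ((x : ℂ) + (y : ℂ) * Complex.I)))‖ ≤ 1 := fun x y hx => by
    rw [Complex.norm_exp, Real.exp_le_one_iff]
    simpa using mul_nonneg hρ.le hx
  have hray : ∀ y : ℝ, |y| = θ → HasSum (fun k : ℕ => z ^ k / (k.factorial : ℂ) *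
      ∫ x in Ioi (0 : ℝ), hankelKernel ((ρ : ℂ) * k + μ) ((x : ℂ) + (y : ℂ) * Complex.I))
      (∫ x in Ioi (0 : ℝ), wrightKernel ρ μ z ((x : ℂ) + (y : ℂ) * Complex.I)) := fun y hy => by
    simp only [hankelKernel_mul_natCast_add, wrightKernel]
    refine hasSum_pow_div_factorial_mul_integral (ν := volume.restrict (Ioi (0 : ℝ)))
      (f := fun x : ℝ => hankelKernel μ ((x : ℂ) + (y : ℂ) * Complex.I))
      (g := fun x : ℝ => Complex.exp (-(ρ * ((x : ℂ) + (y : ℂ) * Complex.I)))) ?_ ?_ ?_ z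
    · refine integrableOn_hankelKernel μ (κ := -Real.cos θ) (by linarith) (by linarith) ?_ 0
      rw [← Real.cos_abs, hy, neg_neg]
    · exact Continuous.aestronglyMeasurable (by fun_prop)
    · filter_upwards [ae_restrict_mem measurableSet_Ioi] with x hx
      exact hnorm x y (le_of_lt hx)
  have harc : HasSum (fun k : ℕ => z ^ k / (k.factorial : ℂ) *
      ∫ y in (-θ)..θ, hankelKernel ((ρ : ℂ) * k + μ) (((0 : ℝ) : ℂ) + (y : ℂ) * Complex.I))
      (∫ y in (-θ)..θ, wrightKernel ρ μ z (((0 : ℝ) : ℂ) + (y : ℂ) * Complex.I)) := by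
    simp only [hankelKernel_mul_natCast_add, wrightKernel,
      intervalIntegral.integral_of_le (show -θ ≤ θ by linarith)]
    refine hasSum_pow_div_factorial_mul_integral (ν := volume.restrict (Ioc (-θ) θ))
      (f := fun y : ℝ => hankelKernel μ (((0 : ℝ) : ℂ) + (y : ℂ) * Complex.I))
      (g := fun y : ℝ => Complex.exp (-(ρ * (((0 : ℝ) : ℂ) + (y : ℂ) * Complex.I)))) ?_ ?_ ?_ z
    · exact Continuous.integrableOn_Ioc (by fun_prop)
    · exact Continuous.aestronglyMeasurable (by fun_prop)
    · exact Eventually.of_forall fun y => hnorm 0 y le_rfl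
  have habs : |θ| = θ := abs_of_pos (by linarith)
  have h := (((hray θ habs).sub (hray (-θ) (by rw [abs_neg, habs]))).add
    (harc.mul_left Complex.I)).div_const (2 * Real.pi * Complex.I)
  refine Eq.trans ?_ h.tsum_eq
  rw [wright]
  congr 1 with k
  have hk := hankelIntegral_pi_hankelKernel ((ρ : ℂ) * k + μ)
  rw [← hankelIntegral_hankelKernel_eq_pi _ h1 h2, hankelIntegral] at hk
  have h2pi : (2 * Real.pi * Complex.I : ℂ) ≠ 0 := Complex.two_pi_I_ne_zero
  rw [eq_div_iff h2pi, ← div_div, div_mul_eq_mul_div, mul_div_assoc, ← hk]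
  ring

lemma norm_wrightKernel_neg (ρ : ℝ) (μ : ℂ) (r x y : ℝ) :
    ‖wrightKernel ρ μ (-(r : ℂ)) ((x : ℂ) + (y : ℂ) * Complex.I)‖
      = ‖hankelKernel μ ((x : ℂ) + (y : ℂ) * Complex.I)‖
        * Real.exp (-(r * (Real.exp (-(ρ * x)) * Real.cos (ρ * y)))) := by
  rw [wrightKernel, norm_mul, Complex.norm_exp (-(r : ℂ) * _)]
  congr 2
  simp [Complex.exp_re]

lemma norm_hankelIntegral_wrightKernel_neg_le {ρ : ℝ} (hρ : 0 < ρ) (μ : ℂ) {θ : ℝ}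
    (h1 : Real.pi / 2 < θ) (h2 : θ ≤ Real.pi) (h3 : ρ * θ ≤ Real.pi / 2) {r c : ℝ} (hr : 0 ≤ r)
    (hc : 0 ≤ c) :
    ‖hankelIntegral θ (wrightKernel ρ μ (-(r : ℂ))) 0‖
      ≤ 2 * (Real.exp (|μ.im| * Real.pi) * (∫ x in Ioi (0 : ℝ),
            Real.exp ((1 - μ.re) * x - (-Real.cos θ / 2) * Real.exp x)))
            * Real.exp (-(-Real.cos θ / 2 * Real.exp c))
        + 2 * θ * Real.exp (Real.exp c + (1 - μ.re) * c + |μ.im| * Real.pi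
            - r * (Real.exp (-(ρ * c)) * Real.cos (ρ * θ))) := by
  have hpi := Real.pi_pos
  have hcosθ := Real.cos_neg_of_pi_div_two_lt_of_lt h1 (by linarith)
  set κ := -Real.cos θ with hκdef
  have hκ : 0 < κ := by linarith
  have hd := differentiable_wrightKernel ρ μ (-(r : ℂ))
  have hcont := hd.continuous
  have hcosρ : ∀ y : ℝ, |y| ≤ θ → Real.cos (ρ * θ) ≤ Real.cos (ρ * y) := fun y hy => by
    rw [← Real.cos_abs (ρ * y), abs_mul, abs_of_pos hρ]
    exact Real.cos_le_cos_of_nonneg_of_le_pi (by positivity) (by linarith) (by gcongr)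
  have hη : 0 ≤ Real.cos (ρ * θ) :=
    Real.cos_nonneg_of_neg_pi_div_two_le_of_le
      (by have := mul_pos hρ (show 0 < θ by linarith); linarith) h3
  have hrayle : ∀ x y : ℝ, |y| = θ → ‖wrightKernel ρ μ (-(r : ℂ)) ((x : ℂ) + y * Complex.I)‖
      ≤ Real.exp (|μ.im| * Real.pi) * Real.exp ((1 - μ.re) * x - κ * Real.exp x) :=
    fun x y hy => by
    rw [norm_wrightKernel_neg]
    refine (mul_le_of_le_one_right (norm_nonneg _) ?_).trans (norm_hankelKernel_le μ
      (by linarith) (by rw [← Real.cos_abs, hy, hκdef, neg_neg]) x)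
    rw [Real.exp_le_one_iff, neg_nonpos]
    exact mul_nonneg hr (mul_nonneg (Real.exp_pos _).le (hη.trans (hcosρ y hy.le)))
  have hint : ∀ y : ℝ, |y| = θ → IntegrableOn
      (fun x : ℝ => wrightKernel ρ μ (-(r : ℂ)) ((x : ℂ) + y * Complex.I)) (Ioi 0) :=
    fun y hy => by
    refine Integrable.mono' ((integrableOn_Ioi_exp_mul_sub_mul_exp (1 - μ.re) hκ 0).const_mul
      (Real.exp (|μ.im| * Real.pi))) ?_ (Eventually.of_forall fun x => hrayle x y hy)
    exact Continuous.aestronglyMeasurable (by fun_prop)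
  have hM := integrableOn_Ioi_exp_mul_sub_mul_exp (1 - μ.re) (half_pos hκ)
  have hray : ∀ y : ℝ, |y| = θ →
      ‖∫ x in Ioi c, wrightKernel ρ μ (-(r : ℂ)) ((x : ℂ) + y * Complex.I)‖
      ≤ Real.exp (|μ.im| * Real.pi) * (∫ x in Ioi (0 : ℝ),
          Real.exp ((1 - μ.re) * x - (κ / 2) * Real.exp x)) * Real.exp (-(κ / 2 * Real.exp c)) :=
    fun y hy => by
    have step : ‖∫ x in Ioi c, wrightKernel ρ μ (-(r : ℂ)) ((x : ℂ) + y * Complex.I)‖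
        ≤ ∫ x in Ioi c, Real.exp (|μ.im| * Real.pi) * Real.exp (-(κ / 2 * Real.exp c))
          * Real.exp ((1 - μ.re) * x - (κ / 2) * Real.exp x) := by
      refine norm_integral_le_of_norm_le ((hM c).const_mul _) ?_
      filter_upwards [ae_restrict_mem measurableSet_Ioi] with x hx
      refine (hrayle x y hy).trans ?_
      rw [mul_assoc, ← Real.exp_add (-(κ / 2 * Real.exp c))]
      gcongr
      have := mul_le_mul_of_nonneg_left (Real.exp_le_exp.2 (le_of_lt hx)) (half_pos hκ).le
      linarith
    rw [integral_const_mul] at step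
    have mono : ∫ x in Ioi c, Real.exp ((1 - μ.re) * x - (κ / 2) * Real.exp x)
        ≤ ∫ x in Ioi (0 : ℝ), Real.exp ((1 - μ.re) * x - (κ / 2) * Real.exp x) :=
      setIntegral_mono_set (hM 0) (Eventually.of_forall fun x => (Real.exp_pos _).le)
        (Ioi_subset_Ioi hc).eventuallyLE
    refine step.trans ?_
    rw [mul_right_comm]
    gcongr
  have harc : ‖∫ y in (-θ)..θ, wrightKernel ρ μ (-(r : ℂ)) ((c : ℂ) + y * Complex.I)‖
      ≤ 2 * θ * Real.exp (Real.exp c + (1 - μ.re) * c + |μ.im| * Real.pi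
            - r * (Real.exp (-(ρ * c)) * Real.cos (ρ * θ))) := by
    have h := intervalIntegral.norm_integral_le_of_norm_le_const (a := -θ) (b := θ)
      (f := fun y : ℝ => wrightKernel ρ μ (-(r : ℂ)) ((c : ℂ) + y * Complex.I))
      (C := Real.exp (Real.exp c + (1 - μ.re) * c + |μ.im| * Real.pi
            - r * (Real.exp (-(ρ * c)) * Real.cos (ρ * θ)))) (fun y hy => by
        rw [uIoc_of_le (by linarith)] at hy
        have hy' : |y| ≤ θ := abs_le.2 ⟨hy.1.le, hy.2⟩
        rw [norm_wrightKernel_neg, norm_hankelKernel, ← Real.exp_add]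
        apply Real.exp_le_exp.2
        have i1 : Real.exp c * Real.cos y ≤ Real.exp c :=
          mul_le_of_le_one_right (Real.exp_pos c).le (Real.cos_le_one y)
        have i2 : μ.im * y ≤ |μ.im| * Real.pi := by
          calc μ.im * y ≤ |μ.im * y| := le_abs_self _
            _ = |μ.im| * |y| := abs_mul _ _
            _ ≤ _ := by gcongr; linarith
        have i3 : r * (Real.exp (-(ρ * c)) * Real.cos (ρ * θ))
            ≤ r * (Real.exp (-(ρ * c)) * Real.cos (ρ * y)) := by
          gcongr
          exact hcosρ y hy'
        linarith)
    rw [abs_of_pos (by linarith : 0 < θ - -θ)] at h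
    linarith
  have habs : |θ| = θ := abs_of_pos (by linarith)
  have habs' : |-θ| = θ := by rw [abs_neg, habs]
  rw [hankelIntegral_eq_of_le hd hc (hint _ habs) (hint _ habs'), hankelIntegral]
  refine norm_add_le_of_le ((norm_sub_le _ _).trans ?_) ?_
  · linarith [hray _ habs, hray _ habs']
  · rw [norm_mul, Complex.norm_I, one_mul]
    exact harc

theorem stmt1 (rho : ℝ) (hrho0 : 0 < rho) (hrho1 : rho < 1) (mu : ℂ) :
    ∃ a L : ℝ, 0 < a ∧ 0 < L ∧ ∀ r : ℝ, 0 ≤ r →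
      ‖wright rho mu (-(r : ℂ))‖ ≤ L * Real.exp (-(a * r ^ (1 / (1 + rho)))) := by
  have hpi := Real.pi_pos
  obtain ⟨θ, hθ⟩ : ∃ θ : ℝ, θ = Real.pi / (1 + rho) := ⟨_, rfl⟩
  have h1 : Real.pi / 2 < θ := by
    rw [hθ]
    gcongr
    linarith
  have h2 : θ ≤ Real.pi := by
    rw [hθ]
    exact div_le_self hpi.le (by linarith)
  have h3 : rho * θ < Real.pi / 2 := by
    have : θ + rho * θ = Real.pi := by
      rw [hθ]
      field_simp
    linarith
  have hcosθ := Real.cos_neg_of_pi_div_two_lt_of_lt h1 (by linarith)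
  have hbound := fun r c => norm_hankelIntegral_wrightKernel_neg_le hrho0 mu h1 h2 h3.le
    (r := r) (c := c)
  have hκ1 : -Real.cos θ ≤ 1 := by linarith [Real.neg_one_le_cos θ]
  have hκ0 : 0 < -Real.cos θ := by linarith
  have hη0 : 0 < Real.cos (rho * θ) :=
    Real.cos_pos_of_mem_Ioo ⟨by have := mul_pos hrho0 (show 0 < θ by linarith); linarith, h3⟩
  have hη1 := Real.cos_le_one (rho * θ)
  generalize -Real.cos θ = κ at hbound hκ1 hκ0
  generalize Real.cos (rho * θ) = η at hbound hη0 hη1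
  obtain ⟨A, hA⟩ : ∃ A : ℝ, A = 2 * (Real.exp (|mu.im| * Real.pi) * (∫ x in Ioi (0 : ℝ),
      Real.exp ((1 - mu.re) * x - (κ / 2) * Real.exp x))) := ⟨_, rfl⟩
  have hA0 : 0 ≤ A := by
    rw [hA]
    have : 0 ≤ ∫ x in Ioi (0 : ℝ), Real.exp ((1 - mu.re) * x - (κ / 2) * Real.exp x) :=
      integral_nonneg fun x => (Real.exp_pos _).le
    positivity
  rw [← hA] at hbound
  obtain ⟨C, hC⟩ := mul_le_mul_exp_add (1 - mu.re) one_pos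
  have hwright : ∀ r : ℝ, ‖wright rho mu (-(r : ℂ))‖
      ≤ ‖hankelIntegral θ (wrightKernel rho mu (-(r : ℂ))) 0‖ := fun r => by
    rw [wright_eq_hankelIntegral hrho0 mu _ h1 h2, norm_div]
    refine div_le_self (norm_nonneg _) ?_
    simp only [norm_mul, Complex.norm_I, Complex.norm_real, Real.norm_eq_abs, abs_of_pos hpi]
    norm_num
    linarith [Real.pi_gt_three]
  obtain ⟨ε, hε⟩ : ∃ ε : ℝ, ε = η / 3 := ⟨_, rfl⟩
  have hε0 : 0 < ε := by rw [hε]; positivity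
  have hε1 : ε ≤ 1 := by linarith
  have hθ0 : 0 < θ := by linarith
  refine ⟨κ / 2 * ε, (A + 2 * θ * Real.exp (C + |mu.im| * Real.pi))
    + (A + 2 * θ * Real.exp (1 + |mu.im| * Real.pi)) * Real.exp 1, by positivity, by positivity,
    fun r hr => (hwright r).trans ?_⟩
  obtain ⟨t, ht⟩ : ∃ t : ℝ, t = r ^ (1 / (1 + rho)) := ⟨_, rfl⟩
  have ht0 : 0 ≤ t := by rw [ht]; positivity
  rw [← ht]
  by_cases hεt : 1 ≤ ε * t
  · have htpos : 0 < t := by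
      by_contra! h
      nlinarith
    have hexp : Real.exp (Real.log (ε * t)) = ε * t := Real.exp_log (by positivity)
    have hc : 0 ≤ Real.log (ε * t) := Real.log_nonneg hεt
    have hb := hbound r (Real.log (ε * t)) hr hc
    have hrt : r * Real.exp (-(rho * Real.log (ε * t))) = t * ε ^ (-rho) := by
      have e1 : Real.exp (-(rho * Real.log (ε * t))) = (ε * t) ^ (-rho) := by
        rw [Real.rpow_def_of_pos (by positivity)]
        congr 1
        ring
      have e2 : r = t ^ (1 + rho) := by
        rw [ht, ← Real.rpow_mul hr, one_div_mul_cancel (by linarith), Real.rpow_one]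
      rw [e1, Real.mul_rpow hε0.le ht0, mul_left_comm]
      nth_rewrite 1 [e2]
      rw [← Real.rpow_add htpos, add_neg_cancel_right, Real.rpow_one, mul_comm]
    have hερ : 1 ≤ ε ^ (-rho) := Real.one_le_rpow_of_pos_of_le_one_of_nonpos hε0 hε1 (by linarith)
    have hCc := hC _ hc
    rw [← mul_assoc, hrt, hexp] at hb
    rw [hexp] at hCc
    have hlow : 3 * (ε * t) ≤ t * ε ^ (-rho) * η := by
      have : t * 1 * η ≤ t * ε ^ (-rho) * η := by gcongr
      have : 3 * (ε * t) = t * 1 * η := by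
        rw [hε]
        ring
      linarith
    have hexp_le : Real.exp (ε * t + (1 - mu.re) * Real.log (ε * t) + |mu.im| * Real.pi
        - t * ε ^ (-rho) * η)
        ≤ Real.exp (C + |mu.im| * Real.pi) * Real.exp (-(κ / 2 * ε * t)) := by
      rw [← Real.exp_add]
      apply Real.exp_le_exp.2
      nlinarith
    calc _ ≤ _ := hb
      _ ≤ A * Real.exp (-(κ / 2 * (ε * t)))
          + 2 * θ * (Real.exp (C + |mu.im| * Real.pi) * Real.exp (-(κ / 2 * ε * t))) := by
        gcongr
      _ = (A + 2 * θ * Real.exp (C + |mu.im| * Real.pi)) * Real.exp (-(κ / 2 * ε * t)) := by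
        ring_nf
      _ ≤ _ := by
        refine mul_le_mul_of_nonneg_right ?_ (Real.exp_pos _).le
        exact le_add_of_nonneg_right (by positivity)
  · push Not at hεt
    have hb := hbound r 0 hr le_rfl
    simp only [Real.exp_zero, mul_zero, neg_zero, mul_one, add_zero, one_mul] at hb
    have hone : 1 ≤ Real.exp 1 * Real.exp (-(κ / 2 * ε * t)) := by
      rw [← Real.exp_add]
      apply Real.one_le_exp
      nlinarith
    have hB0 : 0 ≤ A + 2 * θ * Real.exp (1 + |mu.im| * Real.pi) := by positivity
    calc _ ≤ _ := hb
      _ ≤ A * 1 + 2 * θ * Real.exp (1 + |mu.im| * Real.pi) := by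
        gcongr
        · exact Real.exp_le_one_iff.2 (by linarith)
        · have := mul_nonneg hr hη0.le
          linarith
      _ ≤ (A + 2 * θ * Real.exp (1 + |mu.im| * Real.pi))
          * (Real.exp 1 * Real.exp (-(κ / 2 * ε * t))) := by
        rw [mul_one]
        exact le_mul_of_one_le_right hB0 hone
      _ ≤ _ := by
        rw [← mul_assoc]
        gcongr
        exact le_add_of_nonneg_left (by positivity)
end

section
/- Let α > 0, 0 ≤ δ < β, η = β - δ, m = ⌈η⌉, and let A generate a β-times integrated α-resolvent operator function R_{α,β}. Then A generates a δ-times integrated α-resolvent operator function if and only if there exists an exponentially bounded, strongly continuous mapping R : [0,∞) → B(X) such that R_{α,β}(s)x = (I_{0+}^η R(·)x)(s) for all s ≥ 0 and x ∈ X; in that case the (α,δ)-ROF generated by A is R. -/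
open MeasureTheory Set

variable {X : Type*} [NormedAddCommGroup X] [NormedSpace ℂ X]

open Filter Topology

theorem eqOn_zero_of_laplace_eq_zero {X : Type*} [NormedAddCommGroup X] [NormedSpace ℝ X]
    [CompleteSpace X] {h : ℝ → X} {a : ℝ} (hc : ContinuousOn h (Ici 0))
    (hi : ∀ l, a ≤ l → IntegrableOn (fun t => Real.exp (-(l * t)) • h t) (Ioi 0))
    (hz : ∀ l, a ≤ l → ∫ t in Ioi (0 : ℝ), Real.exp (-(l * t)) • h t = 0) :
    EqOn h 0 (Ici 0) := by
  set h₀ : ℝ → X := fun t => Real.exp (-(a * t)) • h t with hh₀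
  have hi₀ : IntegrableOn h₀ (Ioi 0) := hi a le_rfl
  have hexp : ∀ (n : ℕ) (t : ℝ),
      (Real.exp (-t)) ^ n • h₀ t = Real.exp (-((a + n) * t)) • h t := by
    intro n t
    rw [hh₀, smul_smul, ← Real.exp_nat_mul, ← Real.exp_add]
    ring_nf
  have hpoly : ∀ p : Polynomial ℝ,
      IntegrableOn (fun t => p.eval (Real.exp (-t)) • h₀ t) (Ioi 0) ∧
      ∫ t in Ioi (0 : ℝ), p.eval (Real.exp (-t)) • h₀ t = 0 := by
    intro p
    induction p using Polynomial.induction_on' with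
    | add p q hp hq =>
      simp only [Polynomial.eval_add, add_smul]
      refine ⟨hp.1.add hq.1, ?_⟩
      rw [integral_add hp.1 hq.1, hp.2, hq.2, add_zero]
    | monomial n c =>
      simp only [Polynomial.eval_monomial, mul_smul, hexp]
      have hn : a ≤ a + n := by simp
      refine ⟨(hi _ hn).smul c, ?_⟩
      rw [integral_smul, hz _ hn, smul_zero]
  have hcont : ∀ φ : ℝ → ℝ, ContinuousOn φ (Icc 0 1) →
      IntegrableOn (fun t => φ (Real.exp (-t)) • h₀ t) (Ioi 0) →
      ∫ t in Ioi (0 : ℝ), φ (Real.exp (-t)) • h₀ t = 0 := by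
    intro φ hφ hφi
    have key : ∀ ε > 0, ‖∫ t in Ioi (0 : ℝ), φ (Real.exp (-t)) • h₀ t‖ ≤
        ε * ∫ t in Ioi (0 : ℝ), ‖h₀ t‖ := by
      intro ε hε
      obtain ⟨p, hp⟩ := exists_polynomial_near_of_continuousOn 0 1 φ hφ ε hε
      have hsub : ∫ t in Ioi (0 : ℝ), φ (Real.exp (-t)) • h₀ t =
          ∫ t in Ioi (0 : ℝ), (φ (Real.exp (-t)) • h₀ t - p.eval (Real.exp (-t)) • h₀ t) := by
        rw [integral_sub hφi (hpoly p).1, (hpoly p).2, sub_zero]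
      rw [hsub, ← integral_const_mul]
      refine norm_integral_le_of_norm_le (hi₀.norm.const_mul ε) ?_
      refine (ae_restrict_iff' measurableSet_Ioi).2 (ae_of_all _ fun t ht => ?_)
      rw [← sub_smul, norm_smul, Real.norm_eq_abs, abs_sub_comm]
      gcongr
      exact (hp _ ⟨(Real.exp_pos _).le, Real.exp_le_one_iff.2 (by simpa using (le_of_lt ht))⟩).le
    rw [← norm_eq_zero]
    refine le_antisymm ?_ (norm_nonneg _)
    have hlim : Tendsto (fun ε : ℝ => ε * ∫ t in Ioi (0 : ℝ), ‖h₀ t‖) (𝓝[>] 0) (𝓝 0) := by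
      have : Tendsto (fun ε : ℝ => ε * ∫ t in Ioi (0 : ℝ), ‖h₀ t‖) (𝓝 0)
          (𝓝 (0 * ∫ t in Ioi (0 : ℝ), ‖h₀ t‖)) := tendsto_id.mul_const _
      rw [zero_mul] at this
      exact this.mono_left nhdsWithin_le_nhds
    exact ge_of_tendsto hlim (eventually_mem_nhdsWithin.mono fun ε hε => key ε hε)
  have hae : ∀ᵐ t, t ∈ Ioi (0 : ℝ) → h₀ t = 0 := by
    refine isOpen_Ioi.ae_eq_zero_of_integral_contDiff_smul_eq_zero hi₀.locallyIntegrableOn ?_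
    intro g hg hgc hgs
    have hg0 : ∀ t, t ≤ 0 → g t = 0 := fun t ht =>
      image_eq_zero_of_notMem_tsupport fun hmem => not_lt.2 ht (hgs hmem)
    have hφ : ContinuousOn (fun u : ℝ => g (-Real.log u)) (Icc 0 1) := by
      intro u hu
      rcases hu.1.eq_or_lt with rfl | hu0
      · refine ContinuousAt.continuousWithinAt ?_
        rw [ContinuousAt, ← pure_sup_nhdsNE, tendsto_sup]
        refine ⟨tendsto_pure_nhds (fun u : ℝ => g (-Real.log u)) 0, ?_⟩
        have : Tendsto (fun u : ℝ => -Real.log u) (𝓝[≠] 0) (cocompact ℝ) :=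
          (tendsto_neg_atBot_atTop.comp Real.tendsto_log_nhdsNE_zero).mono_right
            atTop_le_cocompact
        simpa [hg0 0 le_rfl, Function.comp_def] using hgc.is_zero_at_infty.comp this
      · exact (hg.continuous.continuousAt.comp
          (Real.continuousAt_log hu0.ne').neg).continuousWithinAt
    have heq : ∀ t, g (-Real.log (Real.exp (-t))) = g t := fun t => by simp
    have hint : IntegrableOn (fun t => g t • h₀ t) (Ioi 0) := by
      obtain ⟨C, hC⟩ := hgc.exists_bound_of_continuous hg.continuous
      exact hi₀.bdd_smul C hg.continuous.aestronglyMeasurable (ae_of_all _ hC)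
    have hg_int := hcont _ hφ (by simpa only [heq] using hint)
    simp only [heq] at hg_int
    rw [← hg_int, setIntegral_eq_integral_of_forall_compl_eq_zero]
    intro t ht
    rw [hg0 t (not_lt.1 ht), zero_smul]
  have hae' : h =ᵐ[volume.restrict (Ici 0)] 0 := by
    rw [restrict_Ioi_eq_restrict_Ici.symm]
    refine (ae_restrict_iff' measurableSet_Ioi).2 (hae.mono fun t h1 ht => ?_)
    simpa [hh₀, Real.exp_ne_zero] using h1 ht
  exact Measure.eqOn_of_ae_eq hae' hc continuousOn_const (by simp)

theorem integrableOn_exp_smul_of_norm_le {X : Type*} [NormedAddCommGroup X] [NormedSpace ℝ X]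
    {f : ℝ → X} {ω C l : ℝ} (hc : ContinuousOn f (Ici 0))
    (hb : ∀ t, 0 ≤ t → ‖f t‖ ≤ C * Real.exp (ω * t)) (hl : ω < l) :
    IntegrableOn (fun t => Real.exp (-(l * t)) • f t) (Ioi 0) := by
  refine Integrable.mono' ((integrableOn_exp_mul_Ioi (sub_neg.2 hl) 0).const_mul C) ?_ ?_
  · refine ContinuousOn.aestronglyMeasurable ?_ measurableSet_Ioi
    exact (Continuous.continuousOn (by fun_prop)).smul (hc.mono Ioi_subset_Ici_self)
  · refine (ae_restrict_iff' measurableSet_Ioi).2 (ae_of_all _ fun t ht => ?_)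
    rw [norm_smul, Real.norm_eq_abs, Real.abs_exp]
    calc Real.exp (-(l * t)) * ‖f t‖
        ≤ Real.exp (-(l * t)) * (C * Real.exp (ω * t)) := by
          gcongr
          exact hb t (le_of_lt ht)
      _ = C * Real.exp ((ω - l) * t) := by
          rw [mul_left_comm, ← Real.exp_add]
          ring_nf

theorem integral_exp_mul_fracKernel {η l : ℝ} (hη : 0 < η) (hl : 0 < l) :
    ∫ t in Ioi (0 : ℝ), Real.exp (-(l * t)) * (t ^ (η - 1) / Real.Gamma η) = l ^ (-η) := by
  have hΓ : Real.Gamma η ≠ 0 := (Real.Gamma_pos_of_pos hη).ne'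
  have : ∀ t : ℝ, Real.exp (-(l * t)) * (t ^ (η - 1) / Real.Gamma η) =
      (Real.Gamma η)⁻¹ * (t ^ (η - 1) * Real.exp (-(l * t))) := fun t => by ring
  simp_rw [this]
  rw [integral_const_mul, Real.integral_rpow_mul_exp_neg_mul_Ioi hη hl, one_div,
    Real.inv_rpow hl.le, Real.rpow_neg hl.le]
  field_simp

theorem integrableOn_exp_mul_fracKernel {η l : ℝ} (hη : 0 < η) (hl : 0 < l) :
    IntegrableOn (fun t => Real.exp (-(l * t)) * (t ^ (η - 1) / Real.Gamma η)) (Ioi 0) := by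
  by_contra h
  have := integral_exp_mul_fracKernel hη hl
  rw [integral_undef h] at this
  exact (Real.rpow_pos_of_pos hl _).ne this

theorem exp_smul_fracInt {X : Type*} [NormedAddCommGroup X] [NormedSpace ℂ X]
    (η l : ℝ) (f : ℝ → X) {t : ℝ} (ht : 0 ≤ t) :
    Real.exp (-(l * t)) • fracInt η f t =
      ∫ s in (0 : ℝ)..t, (ContinuousLinearMap.lsmul ℝ ℝ : ℝ →L[ℝ] X →L[ℝ] X).flip
        (Real.exp (-(l * s)) • f s)
        (Real.exp (-(l * (t - s))) * ((t - s) ^ (η - 1) / Real.Gamma η)) := by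
  rw [fracInt, intervalIntegral.integral_of_le ht, integral_Ioc_eq_integral_Ioo, ← integral_smul]
  congr 1 with s
  simp only [ContinuousLinearMap.flip_apply, ContinuousLinearMap.lsmul_apply, smul_smul]
  congr 1
  rw [mul_right_comm, ← Real.exp_add]
  ring_nf

theorem integrableOn_exp_smul_fracInt {X : Type*} [NormedAddCommGroup X] [NormedSpace ℂ X]
    {η l : ℝ} (hη : 0 < η) (hl : 0 < l) {f : ℝ → X}
    (hf : IntegrableOn (fun t => Real.exp (-(l * t)) • f t) (Ioi 0)) :
    IntegrableOn (fun t => Real.exp (-(l * t)) • fracInt η f t) (Ioi 0) := by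
  have := integrable_posConvolution hf (integrableOn_exp_mul_fracKernel hη hl)
    (ContinuousLinearMap.lsmul ℝ ℝ : ℝ →L[ℝ] X →L[ℝ] X).flip
  rw [posConvolution, integrable_indicator_iff measurableSet_Ioi] at this
  exact this.congr_fun (fun t ht => (exp_smul_fracInt η l f (le_of_lt ht)).symm) measurableSet_Ioi

theorem integral_exp_smul_fracInt {X : Type*} [NormedAddCommGroup X] [NormedSpace ℂ X]
    [CompleteSpace X] {η l : ℝ} (hη : 0 < η) (hl : 0 < l) {f : ℝ → X}
    (hf : IntegrableOn (fun t => Real.exp (-(l * t)) • f t) (Ioi 0)) :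
    ∫ t in Ioi (0 : ℝ), Real.exp (-(l * t)) • fracInt η f t =
      l ^ (-η) • ∫ t in Ioi (0 : ℝ), Real.exp (-(l * t)) • f t := by
  have := integral_posConvolution hf (integrableOn_exp_mul_fracKernel hη hl)
    (ContinuousLinearMap.lsmul ℝ ℝ : ℝ →L[ℝ] X →L[ℝ] X).flip
  rw [integral_exp_mul_fracKernel hη hl] at this
  rw [setIntegral_congr_fun measurableSet_Ioi
    (fun t ht => exp_smul_fracInt η l f (le_of_lt ht)), this]
  simp

theorem fracInt_eq_smul_integral {X : Type*} [NormedAddCommGroup X] [NormedSpace ℂ X]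
    {η t : ℝ} (hη : 0 < η) (ht : 0 ≤ t) (f : ℝ → X) :
    fracInt η f t =
      t ^ η • ∫ v in (0 : ℝ)..1, ((1 - v) ^ (η - 1) / Real.Gamma η) • f (t * v) := by
  rcases ht.eq_or_lt with rfl | ht0
  · simp [fracInt, Real.zero_rpow hη.ne']
  have hsub := intervalIntegral.smul_integral_comp_mul_left (a := 0) (b := 1)
    (fun s => ((t - s) ^ (η - 1) / Real.Gamma η) • f s) t
  rw [mul_zero, mul_one, intervalIntegral.integral_of_le ht, integral_Ioc_eq_integral_Ioo] at hsub
  rw [fracInt, ← hsub, ← intervalIntegral.integral_smul, ← intervalIntegral.integral_smul]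
  refine intervalIntegral.integral_congr fun v hv => ?_
  rw [uIcc_of_le zero_le_one] at hv
  have h1 : t - t * v = t * (1 - v) := by ring
  have h2 : t ^ η = t * t ^ (η - 1) := by
    rw [Real.rpow_sub_one ht0.ne']
    field_simp
  simp only [smul_smul]
  rw [h1, Real.mul_rpow ht (sub_nonneg.2 hv.2), h2]
  ring_nf

theorem continuousOn_fracInt {X : Type*} [NormedAddCommGroup X] [NormedSpace ℂ X]
    {η : ℝ} (hη : 0 < η) {f : ℝ → X} (hf : ContinuousOn f (Ici 0)) :
    ContinuousOn (fracInt η f) (Ici 0) := by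
  have hker : IntervalIntegrable (fun v : ℝ => (1 - v) ^ (η - 1) / Real.Gamma η) volume 0 1 := by
    have := (intervalIntegral.intervalIntegrable_rpow' (a := 1) (b := 0)
      (show -1 < η - 1 by linarith)).comp_sub_left 1
    simp only [sub_self, sub_zero] at this
    exact this.div_const _
  have hpow : ContinuousOn (fun t : ℝ => t ^ η) (Ici 0) :=
    (Real.continuous_rpow_const hη.le).continuousOn
  suffices h : ContinuousOn (fun t : ℝ =>
      ∫ v in (0 : ℝ)..1, ((1 - v) ^ (η - 1) / Real.Gamma η) • f (t * v)) (Ici 0) from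
    (hpow.smul h).congr fun t ht => fracInt_eq_smul_integral hη ht f
  intro t₀ ht₀
  obtain ⟨C, hC⟩ := (isCompact_Icc (a := (0 : ℝ)) (b := t₀ + 1)).exists_bound_of_continuousOn
    (hf.mono Icc_subset_Ici_self)
  have hcomp : ∀ t, 0 ≤ t → ContinuousOn (fun v => f (t * v)) (Ioc 0 1) := fun t ht =>
    hf.comp (by fun_prop) fun v hv => mul_nonneg ht hv.1.le
  have hnear : ∀ᶠ t in 𝓝[Ici 0] t₀, t ∈ Icc 0 (t₀ + 1) := by
    filter_upwards [self_mem_nhdsWithin,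
      mem_nhdsWithin_of_mem_nhds (Iio_mem_nhds (lt_add_one t₀))] with t h0 h1
    exact ⟨h0, le_of_lt h1⟩
  refine intervalIntegral.continuousWithinAt_of_dominated_interval
    (bound := fun v => ‖(1 - v) ^ (η - 1) / Real.Gamma η‖ * C) ?_ ?_ (hker.norm.mul_const C) ?_
  · filter_upwards [hnear] with t ht
    rw [uIoc_of_le zero_le_one]
    exact hker.1.aestronglyMeasurable.smul
      ((hcomp t ht.1).aestronglyMeasurable measurableSet_Ioc)
  · filter_upwards [hnear] with t ht
    refine ae_of_all _ fun v hv => ?_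
    rw [uIoc_of_le zero_le_one] at hv
    rw [norm_smul]
    gcongr
    exact hC _ ⟨mul_nonneg ht.1 hv.1.le,
      (mul_le_of_le_one_right ht.1 hv.2).trans ht.2⟩
  · refine ae_of_all _ fun v hv => ContinuousWithinAt.const_smul ?_ _
    rw [uIoc_of_le zero_le_one] at hv
    exact (hf.comp (g := f) (f := fun t => t * v) (s := Ici 0) (by fun_prop)
      fun t ht => mul_nonneg ht hv.1.le) t₀ ht₀

theorem IsResolventOf.unique {X : Type*} [NormedAddCommGroup X] [NormedSpace ℂ X]
    {A : X →ₗ.[ℂ] X} {z : ℂ} {R R' : X →L[ℂ] X} (h : IsResolventOf A z R)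
    (h' : IsResolventOf A z R') : R = R' := by
  ext x
  have := h'.left ⟨R x, h.mem x⟩
  rw [h.right x] at this
  exact this.symm

theorem IsROF.completeSpace {X : Type*} [NormedAddCommGroup X] [NormedSpace ℂ X]
    {A : X →ₗ.[ℂ] X} {α β ω M : ℝ} {S : ℝ → X →L[ℂ] X} (hS : IsROF A α β S ω M) :
    CompleteSpace X := by
  by_contra hX
  obtain ⟨R, hR, hlap⟩ := hS.laplace (max ω 0 + 1) (by linarith [le_max_left ω 0])
  have hl : 0 < max ω 0 + 1 := by positivity
  have hR0 : ∀ x, R x = 0 := fun x => by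
    have := hlap x
    rw [integral_of_not_completeSpace hX, smul_eq_zero] at this
    exact this.resolve_left (Complex.ofReal_ne_zero.2 (Real.rpow_pos_of_pos hl _).ne')
  have hx0 : ∀ x : X, x = 0 := fun x => by
    have h := hR.right x
    have h0 : (⟨R x, hR.mem x⟩ : A.domain) = 0 := Subtype.ext (hR0 x)
    rw [h0, hR0 x, smul_zero, A.map_zero, sub_zero] at h
    exact h.symm
  have : Subsingleton X := ⟨fun x y => (hx0 x).trans (hx0 y).symm⟩
  exact hX inferInstance

theorem IsROF.eq_fracInt {X : Type*} [NormedAddCommGroup X] [NormedSpace ℂ X]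
    {A : X →ₗ.[ℂ] X} {α β δ ω M ω' M' : ℝ} {S T : ℝ → X →L[ℂ] X} (hδβ : δ < β)
    (hS : IsROF A α β S ω M) (hT : IsROF A α δ T ω' M') {s : ℝ} (hs : 0 ≤ s) (x : X) :
    S s x = fracInt (β - δ) (fun t => T t x) s := by
  have : CompleteSpace X := hS.completeSpace
  have hη : 0 < β - δ := sub_pos.2 hδβ
  have hbound : ∀ {V : ℝ → X →L[ℂ] X} {w C : ℝ}, (∀ t, 0 ≤ t → ‖V t‖ ≤ C * Real.exp (w * t)) →
      ∀ t, 0 ≤ t → ‖V t x‖ ≤ C * ‖x‖ * Real.exp (w * t) := fun {V w C} hV t ht => by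
    rw [mul_right_comm]
    exact (V t).le_of_opNorm_le (hV t ht) x
  set a := max (max ω ω') 0 + 1
  have ha : ∀ l, a ≤ l → ω < l ∧ ω' < l ∧ 0 < l := fun l hl => by
    have h1 := le_max_left ω ω'
    have h2 := le_max_right ω ω'
    have h3 := le_max_left (max ω ω') 0
    have h4 := le_max_right (max ω ω') 0
    have h5 : max (max ω ω') 0 + 1 ≤ l := hl
    exact ⟨by linarith, by linarith, by linarith⟩
  have hiS : ∀ l, a ≤ l → IntegrableOn (fun t => Real.exp (-(l * t)) • S t x) (Ioi 0) :=
    fun l hl => integrableOn_exp_smul_of_norm_le (hS.cont x) (hbound hS.bound) (ha l hl).1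
  have hiT : ∀ l, a ≤ l → IntegrableOn (fun t => Real.exp (-(l * t)) • T t x) (Ioi 0) :=
    fun l hl => integrableOn_exp_smul_of_norm_le (hT.cont x) (hbound hT.bound) (ha l hl).2.1
  have hiF : ∀ l, a ≤ l → IntegrableOn
      (fun t => Real.exp (-(l * t)) • fracInt (β - δ) (fun t => T t x) t) (Ioi 0) :=
    fun l hl => integrableOn_exp_smul_fracInt hη (ha l hl).2.2 (hiT l hl)
  have hzero := eqOn_zero_of_laplace_eq_zero (a := a)
    (h := fun t => S t x - fracInt (β - δ) (fun t => T t x) t)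
    ((hS.cont x).sub (continuousOn_fracInt hη (hT.cont x)))
    (fun l hl => by
      simp only [smul_sub]
      exact (hiS l hl).sub (hiF l hl))
    (fun l hl => by
      obtain ⟨h1, h2, h3⟩ := ha l hl
      obtain ⟨R, hR, hRS⟩ := hS.laplace l h1
      obtain ⟨R', hR', hRT⟩ := hT.laplace l h2
      obtain rfl := hR.unique hR'
      simp only [smul_sub]
      rw [integral_sub (hiS l hl) (hiF l hl), integral_exp_smul_fracInt hη h3 (hiT l hl),
        ← hRS, ← hRT, ← Complex.coe_smul, smul_smul, ← Complex.ofReal_mul,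
        ← Real.rpow_add h3, sub_eq_zero]
      ring_nf)
  exact sub_eq_zero.1 (hzero hs)

theorem IsROF.of_eq_fracInt {X : Type*} [NormedAddCommGroup X] [NormedSpace ℂ X]
    {A : X →ₗ.[ℂ] X} {α β δ ω M ω' M' : ℝ} {S T : ℝ → X →L[ℂ] X} (hδβ : δ < β)
    (hS : IsROF A α β S ω M) (hc : ∀ x : X, ContinuousOn (fun t : ℝ => T t x) (Ici 0))
    (hb : ∀ t : ℝ, 0 ≤ t → ‖T t‖ ≤ M' * Real.exp (ω' * t))
    (hST : ∀ s : ℝ, 0 ≤ s → ∀ x : X, S s x = fracInt (β - δ) (fun t => T t x) s) :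
    IsROF A α δ T (max (max ω ω') 0) M' := by
  have : CompleteSpace X := hS.completeSpace
  have hη : 0 < β - δ := sub_pos.2 hδβ
  have hM' : 0 ≤ M' := by simpa using (norm_nonneg _).trans (hb 0 le_rfl)
  refine ⟨hc, fun t ht => (hb t ht).trans ?_, fun l hl => ?_⟩
  · gcongr
    exact (le_max_right ω ω').trans (le_max_left _ _)
  · obtain ⟨h12, h3⟩ := max_lt_iff.1 hl
    obtain ⟨h1, h2⟩ := max_lt_iff.1 h12
    obtain ⟨R, hR, hRS⟩ := hS.laplace l h1
    refine ⟨R, hR, fun x => ?_⟩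
    have hbx : ∀ t, 0 ≤ t → ‖T t x‖ ≤ M' * ‖x‖ * Real.exp (ω' * t) := fun t ht => by
      rw [mul_right_comm]
      exact (T t).le_of_opNorm_le (hb t ht) x
    have h := hRS x
    rw [setIntegral_congr_fun measurableSet_Ioi fun t ht => by
        simp only [hST t (le_of_lt ht) x]; rfl,
      integral_exp_smul_fracInt hη h3 (integrableOn_exp_smul_of_norm_le (hc x) hbx h2)] at h
    have h' := congrArg (fun y => (l ^ (β - δ) : ℝ) • y) h
    simp only [← Complex.coe_smul (l ^ (β - δ) : ℝ), smul_smul, ← Complex.ofReal_mul,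
      ← Complex.coe_smul (l ^ (-(β - δ)) : ℝ), ← Real.rpow_add h3, add_neg_cancel,
      Real.rpow_zero, Complex.ofReal_one, one_smul] at h'
    rw [← h']
    ring_nf

theorem stmt7 {X : Type*} [NormedAddCommGroup X] [NormedSpace ℂ X]
    (A : X →ₗ.[ℂ] X) (alpha beta delta : ℝ) (halpha : 0 < alpha)
    (hdelta : 0 ≤ delta) (hdb : delta < beta)
    (S : ℝ → X →L[ℂ] X) (omega M : ℝ) (hS : IsROF A alpha beta S omega M) :
    ((∃ (T : ℝ → X →L[ℂ] X) (omega' M' : ℝ), IsROF A alpha delta T omega' M') ↔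
      (∃ (T : ℝ → X →L[ℂ] X) (omega' M' : ℝ),
        (∀ x : X, ContinuousOn (fun t : ℝ => T t x) (Set.Ici 0)) ∧
        (∀ t : ℝ, 0 ≤ t → ‖T t‖ ≤ M' * Real.exp (omega' * t)) ∧
        ∀ s : ℝ, 0 ≤ s → ∀ x : X,
          S s x = fracInt (beta - delta) (fun t => T t x) s)) ∧
    (∀ (T : ℝ → X →L[ℂ] X) (omega' M' : ℝ),
      (∀ x : X, ContinuousOn (fun t : ℝ => T t x) (Set.Ici 0)) →
      (∀ t : ℝ, 0 ≤ t → ‖T t‖ ≤ M' * Real.exp (omega' * t)) →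
      (∀ s : ℝ, 0 ≤ s → ∀ x : X,
        S s x = fracInt (beta - delta) (fun t => T t x) s) →
      ∃ omega'' M'' : ℝ, IsROF A alpha delta T omega'' M'') := by
  refine ⟨⟨?_, ?_⟩, ?_⟩
  · rintro ⟨T, omega', M', hT⟩
    exact ⟨T, omega', M', hT.cont, hT.bound, fun s hs x => hS.eq_fracInt hdb hT hs x⟩
  · rintro ⟨T, omega', M', hc, hb, hST⟩
    exact ⟨T, _, _, hS.of_eq_fracInt hdb hc hb hST⟩
  · intro T omega' M' hc hb hST
    exact ⟨_, _, hS.of_eq_fracInt hdb hc hb hST⟩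
end

section
/- Let α > 2, β ≥ 0, and let A be a densely defined operator generating an (α,β)-ROF R_{α,β} satisfying ‖R_{α,β}(t)‖ ≤ C t^β e^{ωt} for all t ≥ 0 and some constants C, ω ≥ 0. Then A is a bounded operator on X. -/
open MeasureTheory Set

variable {X : Type*} [NormedAddCommGroup X] [NormedSpace ℂ X]

open Filter Topology

namespace IsResolventOf

variable {A : X →ₗ.[ℂ] X} {z w : ℂ} {R T : X →L[ℂ] X}

/-- The first resolvent identity. -/
theorem sub_eq (hR : IsResolventOf A z R) (hT : IsResolventOf A w T) :
    R - T = (w - z) • (R * T) := by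
  ext x
  have h := hR.left ⟨T x, hT.mem x⟩
  have h2 : A ⟨T x, hT.mem x⟩ = w • T x - x := by
    rw [eq_sub_iff_add_eq, ← eq_sub_iff_add_eq']; exact (hT.right x).symm
  rw [h2] at h
  simp only [map_sub, map_smul] at h
  simp only [sub_apply, smul_apply, mul_apply_eq_comp]
  linear_combination (norm := module) h

/-- On the domain, `z R(z) y - y = R(z) A y`. -/
theorem smul_apply_sub (hR : IsResolventOf A z R) (y : A.domain) :
    z • R y - y = R (A y) := by
  have h := hR.left y
  simp only [map_sub, map_smul] at h
  linear_combination (norm := module) h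

/-- An operator one of whose resolvents is surjective is everywhere defined. -/
theorem domain_eq_top (hR : IsResolventOf A z R) (hsurj : Function.Surjective R) :
    A.domain = ⊤ := by
  refine eq_top_iff.2 fun x _ => ?_
  obtain ⟨y, rfl⟩ := hsurj x
  exact hR.mem y

/-- An operator one of whose resolvents has a bounded left inverse is bounded. -/
theorem norm_apply_le (hR : IsResolventOf A z R) {B : X →L[ℂ] X} (hB : B * R = 1)
    (x : A.domain) : ‖A x‖ ≤ (‖z‖ + ‖B‖) * ‖(x : X)‖ := by
  have h : z • (x : X) - A x = B x := by
    have h1 := congrArg B (hR.left x)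
    rw [← h1, ← mul_apply_eq_comp, hB]; rfl
  have h2 : A x = z • (x : X) - B x := by rw [← h]; abel
  rw [h2, add_mul, ← norm_smul]
  exact (norm_sub_le _ _).trans (by gcongr; exact B.le_opNorm _)

end IsResolventOf

/-- A family of resolvents on an open set is holomorphic. -/
theorem differentiableAt_of_isResolventOf [CompleteSpace X] {A : X →ₗ.[ℂ] X}
    {F : ℂ → X →L[ℂ] X} {w : ℂ} (hF : ∀ᶠ z in 𝓝 w, IsResolventOf A z (F z)) :
    DifferentiableAt ℂ F w := by
  set U : ℂ → X →L[ℂ] X := fun z => 1 + (z - w) • F w with hU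
  have hUd : DifferentiableAt ℂ U w := by fun_prop
  have hUw : IsUnit (U w) := by simp [hU]
  have hUu : ∀ᶠ z in 𝓝 w, IsUnit (U z) :=
    hUd.continuousAt.eventually (Units.isOpen.mem_nhds hUw)
  have hd : DifferentiableAt ℂ (fun z => F w * Ring.inverse (U z)) w := by
    have h1 : DifferentiableAt ℂ (Ring.inverse : (X →L[ℂ] X) → _) (U w) :=
      differentiableAt_inverse hUw
    exact (differentiableAt_const _).mul (DifferentiableAt.comp w h1 hUd)
  refine hd.congr_of_eventuallyEq ?_
  filter_upwards [hF, hUu] with z hz hu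
  rw [Ring.eq_mul_inverse_iff_mul_eq _ _ _ hu]
  have := hz.sub_eq hF.self_of_nhds
  simp only [hU, mul_add, mul_one, mul_smul_comm]
  linear_combination (norm := module) this

/-- A densely defined operator whose resolvent exists and is `O(1/|z|)` near infinity is
bounded and everywhere defined. -/
theorem bounded_of_resolvent_bound [CompleteSpace X] {A : X →ₗ.[ℂ] X}
    (hdense : Dense (A.domain : Set X)) {r K : ℝ}
    (h : ∀ z : ℂ, r < ‖z‖ → ∃ R : X →L[ℂ] X, IsResolventOf A z R ∧ ‖z‖ * ‖R‖ ≤ K) :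
    A.domain = ⊤ ∧ ∃ C : ℝ, ∀ x : A.domain, ‖A x‖ ≤ C * ‖(x : X)‖ := by
  choose! F hF hK using h
  set G : ℂ → X →L[ℂ] X := fun w => w⁻¹ • F w⁻¹ with hG
  have hev : ∀ᶠ w : ℂ in 𝓝[≠] 0, r < ‖w⁻¹‖ :=
    (tendsto_norm_inv_nhdsNE_zero_atTop (α := ℂ)).eventually_gt_atTop r
  have hne : ∀ᶠ w : ℂ in 𝓝[≠] 0, w ≠ 0 := eventually_mem_nhdsWithin
  have hGK : ∀ᶠ w in 𝓝[≠] 0, ‖G w‖ ≤ K := by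
    filter_upwards [hev] with w hw
    rw [hG, norm_smul]
    exact hK _ hw
  have hGd : ∀ᶠ w in 𝓝[≠] 0, DifferentiableAt ℂ G w := by
    filter_upwards [hev, hne] with w hw hw0
    have hFd : DifferentiableAt ℂ F w⁻¹ :=
      differentiableAt_of_isResolventOf
        ((continuous_norm.continuousAt.eventually (lt_mem_nhds hw)).mono fun z hz => hF z hz)
    exact (differentiableAt_inv hw0).smul
      (DifferentiableAt.comp w hFd (differentiableAt_inv hw0))
  have hlim : Tendsto G (𝓝[≠] 0) (𝓝 (limUnder (𝓝[≠] 0) G)) := by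
    refine Complex.tendsto_limUnder_of_differentiable_on_punctured_nhds_of_bounded_under hGd ?_
    refine ⟨K + ‖G 0‖, eventually_map.2 (hGK.mono fun w hw => ?_)⟩
    exact norm_sub_le_of_le hw le_rfl
  set L := limUnder (𝓝[≠] 0) G
  have hL1 : ∀ y ∈ (A.domain : Set X), L y = y := by
    intro y hy
    have h1 : Tendsto (fun w => G w y) (𝓝[≠] 0) (𝓝 (L y)) :=
      ((ContinuousLinearMap.apply ℂ X y).continuous.tendsto L).comp hlim
    refine tendsto_nhds_unique h1 (tendsto_iff_norm_sub_tendsto_zero.2 ?_)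
    have h0 : Tendsto (fun w : ℂ => ‖w‖ * (K * ‖A ⟨y, hy⟩‖)) (𝓝[≠] 0) (𝓝 0) := by
      have : Tendsto (fun w : ℂ => ‖w‖ * (K * ‖A ⟨y, hy⟩‖)) (𝓝 0) (𝓝 (‖(0 : ℂ)‖ * _)) :=
        (continuous_norm.mul continuous_const).tendsto 0
      simpa using this.mono_left nhdsWithin_le_nhds
    refine squeeze_zero' (Eventually.of_forall fun _ => norm_nonneg _) ?_ h0
    filter_upwards [hev, hne, hGK] with w hw hw0 hb
    have h2 := (hF _ hw).smul_apply_sub ⟨y, hy⟩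
    have h3 : F w⁻¹ (A ⟨y, hy⟩) = w • G w (A ⟨y, hy⟩) := by
      simp [hG, smul_smul, hw0]
    calc ‖G w y - y‖ = ‖w • G w (A ⟨y, hy⟩)‖ := by rw [← h3, ← h2]; simp [hG]
      _ ≤ ‖w‖ * (K * ‖A ⟨y, hy⟩‖) := by
        rw [norm_smul]
        gcongr
        exact (G w).le_of_opNorm_le hb _
  have hL : L = 1 := by
    ext y
    exact congrFun (L.continuous.ext_on hdense continuous_id hL1) y
  rw [hL] at hlim
  have hu : ∀ᶠ w in 𝓝[≠] 0, IsUnit (G w) :=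
    hlim.eventually (Units.isOpen.mem_nhds isUnit_one)
  obtain ⟨w, hw, hw0, u, hwu⟩ := (hev.and (hne.and hu)).exists
  have hFu : F w⁻¹ = w • (u : X →L[ℂ] X) := by simp [hwu, hG, smul_smul, hw0]
  have hl : (w⁻¹ • (↑u⁻¹ : X →L[ℂ] X)) * F w⁻¹ = 1 := by
    simp [hFu, smul_smul, hw0]
  have hr : F w⁻¹ * (w⁻¹ • (↑u⁻¹ : X →L[ℂ] X)) = 1 := by
    simp [hFu, smul_smul, hw0]
  refine ⟨(hF _ hw).domain_eq_top fun x => ⟨(w⁻¹ • (↑u⁻¹ : X →L[ℂ] X)) x, ?_⟩,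
    _, (hF _ hw).norm_apply_le hl⟩
  rw [← mul_apply_eq_comp, hr]; rfl

/-- The Laplace integrand of an exponentially bounded continuous function is integrable. -/
theorem integrableOn_laplace {f : ℝ → X} {ω M : ℝ} {l : ℂ} (hf : ContinuousOn f (Ici 0))
    (hb : ∀ t, 0 ≤ t → ‖f t‖ ≤ M * Real.exp (ω * t)) (hl : ω < l.re) :
    IntegrableOn (fun t : ℝ => Complex.exp (-(l * t)) • f t) (Ioi 0) := by
  have hc : ContinuousOn (fun t : ℝ => Complex.exp (-(l * t)) • f t) (Ioi 0) :=
    ContinuousOn.smul (by fun_prop) (hf.mono Ioi_subset_Ici_self)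
  refine Integrable.mono' ((integrableOn_exp_mul_Ioi (sub_neg.2 hl) 0).const_mul M)
    (hc.aestronglyMeasurable measurableSet_Ioi) ?_
  filter_upwards [ae_restrict_mem measurableSet_Ioi] with t ht
  have ht : 0 < t := ht
  calc ‖Complex.exp (-(l * t)) • f t‖ ≤ Real.exp (-(l.re * t)) * (M * Real.exp (ω * t)) := by
        rw [norm_smul, Complex.norm_exp]
        simp only [Complex.neg_re, Complex.re_mul_ofReal]
        gcongr
        exact hb t ht.le
    _ = M * Real.exp ((ω - l.re) * t) := by
        rw [mul_left_comm, ← Real.exp_add]; ring_nf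

/-- The Laplace transform is holomorphic in the half-plane of absolute convergence. -/
theorem differentiableAt_laplace {f : ℝ → X} {ω M : ℝ} {l : ℂ} (hf : ContinuousOn f (Ici 0))
    (hb : ∀ t, 0 ≤ t → ‖f t‖ ≤ M * Real.exp (ω * t)) (hl : ω < l.re) :
    DifferentiableAt ℂ (fun l : ℂ => ∫ t in Ioi (0 : ℝ), Complex.exp (-(l * t)) • f t) l := by
  obtain ⟨σ, hωσ, hσl⟩ := exists_between hl
  have hs : {z : ℂ | σ < z.re} ∈ 𝓝 l :=
    (isOpen_lt continuous_const Complex.continuous_re).mem_nhds hσl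
  have hint : IntegrableOn (fun t : ℝ => M * (t ^ (1 : ℝ) * Real.exp (-(σ - ω) * t ^ (1 : ℝ))))
      (Ioi 0) :=
    (integrableOn_rpow_mul_exp_neg_mul_rpow (by norm_num) one_pos (sub_pos.2 hωσ)).const_mul M
  refine (hasDerivAt_integral_of_dominated_loc_of_deriv_le (μ := volume.restrict (Ioi 0))
    (F := fun (z : ℂ) (t : ℝ) => Complex.exp (-(z * t)) • f t)
    (F' := fun (z : ℂ) (t : ℝ) => (Complex.exp (-(z * t)) * -(t : ℂ)) • f t) hs ?_
    (integrableOn_laplace hf hb hl) ?_ ?_ hint ?_).2.differentiableAt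
  · filter_upwards [hs] with z hz
    exact (integrableOn_laplace hf hb (hωσ.trans hz)).aestronglyMeasurable
  · have hc : ContinuousOn (fun t : ℝ => (Complex.exp (-(l * t)) * -(t : ℂ)) • f t) (Ioi 0) :=
      ContinuousOn.smul (by fun_prop) (hf.mono Ioi_subset_Ici_self)
    exact hc.aestronglyMeasurable measurableSet_Ioi
  · filter_upwards [ae_restrict_mem measurableSet_Ioi] with t ht z hz
    have ht : 0 < t := ht
    have hz : σ < z.re := hz
    have hexp : Real.exp (-(z.re * t)) ≤ Real.exp (-(σ * t)) := by gcongr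
    calc ‖(Complex.exp (-(z * t)) * -(t : ℂ)) • f t‖
        ≤ Real.exp (-(σ * t)) * t * (M * Real.exp (ω * t)) := by
          rw [norm_smul, norm_mul, Complex.norm_exp, norm_neg, Complex.norm_real,
            Real.norm_of_nonneg ht.le]
          simp only [Complex.neg_re, Complex.re_mul_ofReal]
          gcongr
          exact hb t ht.le
      _ = M * (t * (Real.exp (-(σ * t)) * Real.exp (ω * t))) := by ring
      _ = M * (t ^ (1 : ℝ) * Real.exp (-(σ - ω) * t ^ (1 : ℝ))) := by
          rw [← Real.exp_add, Real.rpow_one]; ring_nf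
  · refine Eventually.of_forall fun t z _ => HasDerivAt.smul_const ?_ (f t)
    exact ((hasDerivAt_mul_const (t : ℂ)).neg).cexp

/-- Laplace transform estimate for functions of growth `t ^ β * exp (ω t)`. -/
theorem norm_laplace_le {f : ℝ → X} {ω C β : ℝ} {l : ℂ} (hβ : 0 ≤ β)
    (hb : ∀ t, 0 ≤ t → ‖f t‖ ≤ C * t ^ β * Real.exp (ω * t)) (hl : ω < l.re) :
    ‖∫ t in Ioi (0 : ℝ), Complex.exp (-(l * t)) • f t‖ ≤
      C * ((1 / (l.re - ω)) ^ (β + 1) * Real.Gamma (β + 1)) := by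
  have hl' : 0 < l.re - ω := sub_pos.2 hl
  have key := Real.integral_rpow_mul_exp_neg_mul_Ioi (a := β + 1) (by positivity) hl'
  rw [add_sub_cancel_right] at key
  have hi : IntegrableOn (fun t : ℝ => t ^ β * Real.exp (-((l.re - ω) * t))) (Ioi 0) :=
    .of_integral_ne_zero (by
      rw [key]
      have := Real.Gamma_pos_of_pos (show 0 < β + 1 by positivity)
      positivity)
  rw [← key, ← integral_const_mul]
  refine norm_integral_le_of_norm_le (hi.const_mul C) ?_
  filter_upwards [ae_restrict_mem measurableSet_Ioi] with t ht
  have ht : 0 < t := ht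
  calc ‖Complex.exp (-(l * t)) • f t‖
      ≤ Real.exp (-(l.re * t)) * (C * t ^ β * Real.exp (ω * t)) := by
        rw [norm_smul, Complex.norm_exp]
        simp only [Complex.neg_re, Complex.re_mul_ofReal]
        gcongr
        exact hb t ht.le
    _ = C * (t ^ β * (Real.exp (-(l.re * t)) * Real.exp (ω * t))) := by ring
    _ = C * (t ^ β * Real.exp (-((l.re - ω) * t))) := by
        rw [← Real.exp_add]; ring_nf

/-- Holomorphic functions on a right half-plane agreeing on the real axis agree. -/
theorem eqOn_halfPlane [CompleteSpace X] {f g : ℂ → X} {ω : ℝ}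
    (hf : DifferentiableOn ℂ f {l | ω < l.re}) (hg : DifferentiableOn ℂ g {l | ω < l.re})
    (h : ∀ l : ℝ, ω < l → f l = g l) : EqOn f g {l | ω < l.re} := by
  have ho : IsOpen {l : ℂ | ω < l.re} := isOpen_lt continuous_const Complex.continuous_re
  refine (hf.analyticOnNhd ho).eqOn_of_preconnected_of_frequently_eq (hg.analyticOnNhd ho)
    (convex_halfSpace_re_gt ω).isPreconnected (z₀ := ((ω + 1 : ℝ) : ℂ)) (by simp) ?_
  have ht : Tendsto (fun t : ℝ => (t : ℂ)) (𝓝[≠] (ω + 1)) (𝓝[≠] ((ω + 1 : ℝ) : ℂ)) :=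
    Complex.continuous_ofReal.continuousWithinAt.tendsto_nhdsWithin fun t ht => by
      simpa only [mem_compl_iff, mem_singleton_iff, Complex.ofReal_inj] using ht
  refine ht.frequently (Eventually.frequently ?_)
  filter_upwards [nhdsWithin_le_nhds (lt_mem_nhds (lt_add_one ω))] with t hlt
  exact h t hlt

namespace IsROF

variable {A : X →ₗ.[ℂ] X} {α β ω M C : ℝ} {S : ℝ → X →L[ℂ] X}

/-- The Laplace identity forces completeness: in an incomplete space the Bochner integral
vanishes, so the resolvent does too, which is possible only if `X` is trivial. -/
theorem completeSpace_s9 (hS : IsROF A α β S ω M) (hω : 0 ≤ ω) : CompleteSpace X := by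
  by_contra hX
  obtain ⟨R, hR, hRx⟩ := hS.laplace (ω + 1) (lt_add_one ω)
  have hR0 : ∀ x, R x = 0 := fun x => by
    have h := hRx x
    rw [integral_of_not_completeSpace hX, smul_eq_zero, Complex.ofReal_eq_zero] at h
    exact h.resolve_left (Real.rpow_pos_of_pos (by positivity) _).ne'
  have hx0 : ∀ x : X, x = 0 := fun x => by
    have h := hR.right x
    have h0 : (⟨R x, hR.mem x⟩ : A.domain) = 0 := Subtype.ext (hR0 x)
    rw [h0, hR0, LinearPMap.map_zero, smul_zero, sub_zero] at h
    exact h.symm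
  have : Subsingleton X := ⟨fun a b => (hx0 a).trans (hx0 b).symm⟩
  exact hX inferInstance

theorem norm_apply_le_exp (hS : IsROF A α β S ω M) (x : X) (t : ℝ) (ht : 0 ≤ t) :
    ‖S t x‖ ≤ M * ‖x‖ * Real.exp (ω * t) := by
  rw [mul_right_comm]
  exact (S t).le_of_opNorm_le (hS.bound t ht) x

/-- If `‖S t‖ ≤ C t ^ β exp (ω t)`, then the Laplace transform of `S` provides resolvents of `A`
at `l ^ α` for all `l` in a right half-plane. -/
theorem exists_resolvent [CompleteSpace X] (hS : IsROF A α β S ω M) (hω : 0 ≤ ω) (hβ : 0 ≤ β)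
    (hbd : ∀ t : ℝ, 0 ≤ t → ‖S t‖ ≤ C * t ^ β * Real.exp (ω * t)) (hC : 0 ≤ C)
    {l : ℂ} (hl : ω < l.re) :
    ∃ R : X →L[ℂ] X, IsResolventOf A (l ^ (α : ℂ)) R ∧
      ‖R‖ ≤ ‖l‖ ^ (β + 1 - α) * (C * ((1 / (l.re - ω)) ^ (β + 1) * Real.Gamma (β + 1))) := by
  have hpos : ∀ {l : ℂ}, ω < l.re → l ∈ Complex.slitPlane := fun h => Or.inl (hω.trans_lt h)
  set I : X → ℂ → X := fun x l => ∫ t in Ioi (0 : ℝ), Complex.exp (-(l * t)) • S t x with hI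
  set H : X → ℂ → X := fun x l => l ^ ((β + 1 - α : ℝ) : ℂ) • I x l with hH
  have hpow : ∀ c : ℂ, DifferentiableOn ℂ (fun l : ℂ => l ^ c) {l | ω < l.re} :=
    fun c z hz => ((differentiableAt_id).cpow_const (hpos hz)).differentiableWithinAt
  have hHd : ∀ x, DifferentiableOn ℂ (H x) {l | ω < l.re} := fun x =>
    (hpow _).smul fun z hz =>
      (differentiableAt_laplace (hS.cont x) (hS.norm_apply_le_exp x) hz).differentiableWithinAt
  have hint : ∀ (x : X) {l : ℂ}, ω < l.re →
      IntegrableOn (fun t : ℝ => Complex.exp (-(l * t)) • S t x) (Ioi 0) := fun x l h =>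
    integrableOn_laplace (hS.cont x) (hS.norm_apply_le_exp x) h
  have hreal : ∀ m : ℝ, ω < m → ∃ R : X →L[ℂ] X, IsResolventOf A ((m : ℂ) ^ (α : ℂ)) R ∧
      ∀ x, R x = H x m := by
    intro m hm
    have hm0 : 0 < m := hω.trans_lt hm
    obtain ⟨R, hR, hRx⟩ := hS.laplace m hm
    refine ⟨R, by rwa [← Complex.ofReal_cpow hm0.le], fun x => ?_⟩
    have hIx : I x m = ((m ^ (α - β - 1) : ℝ) : ℂ) • R x := by
      rw [hRx, hI]
      refine integral_congr_ae (Eventually.of_forall fun t => ?_)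
      dsimp only
      rw [← Complex.coe_smul]
      push_cast
      rfl
    rw [hH]
    simp only [hIx, smul_smul, ← Complex.ofReal_cpow hm0.le, ← Complex.ofReal_mul,
      ← Real.rpow_add hm0]
    rw [show β + 1 - α + (α - β - 1) = 0 by ring]
    simp
  have hnorm : ∀ x, ‖H x l‖ ≤
      ‖l‖ ^ (β + 1 - α) * (C * ((1 / (l.re - ω)) ^ (β + 1) * Real.Gamma (β + 1))) * ‖x‖ := by
    intro x
    have hb : ‖I x l‖ ≤ C * ‖x‖ * ((1 / (l.re - ω)) ^ (β + 1) * Real.Gamma (β + 1)) := by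
      refine norm_laplace_le hβ (fun t ht => ?_) hl
      calc ‖S t x‖ ≤ C * t ^ β * Real.exp (ω * t) * ‖x‖ := (S t).le_of_opNorm_le (hbd t ht) x
        _ = C * ‖x‖ * t ^ β * Real.exp (ω * t) := by ring
    calc ‖H x l‖ ≤ ‖l‖ ^ (β + 1 - α) *
          (C * ‖x‖ * ((1 / (l.re - ω)) ^ (β + 1) * Real.Gamma (β + 1))) := by
          rw [hH, norm_smul, Complex.norm_cpow_real]
          gcongr
      _ = _ := by ring
  let R : X →L[ℂ] X := LinearMap.mkContinuous
    { toFun := fun x => H x l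
      map_add' := fun x y => by
        simp only [hH, hI, map_add, smul_add]
        rw [integral_add (hint x hl) (hint y hl), smul_add]
      map_smul' := fun c x => by
        simp only [hH, hI, map_smul, RingHom.id_apply]
        simp_rw [smul_comm _ c]
        rw [integral_smul, smul_comm] } _ hnorm
  have hRx : ∀ x, R x = H x l := fun x => rfl
  have hgamma := Real.Gamma_pos_of_pos (show 0 < β + 1 by positivity)
  have hlω : 0 < l.re - ω := sub_pos.2 hl
  have hleft : ∀ y : A.domain, R (l ^ (α : ℂ) • (y : X) - A y) = y := by
    intro y
    rw [map_sub, map_smul, hRx, hRx]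
    refine eqOn_halfPlane (f := fun z => z ^ (α : ℂ) • H y z - H (A y) z) (g := fun _ => (y : X))
      (((hpow _).smul (hHd _)).sub (hHd _)) (differentiableOn_const _) (fun m hm => ?_) hl
    obtain ⟨T, hT, hTx⟩ := hreal m hm
    rw [← hTx, ← hTx, ← map_smul, ← map_sub]
    exact hT.left y
  obtain ⟨T, hT, -⟩ := hreal (ω + 1) (lt_add_one ω)
  set w : ℂ := ((ω + 1 : ℝ) : ℂ) ^ (α : ℂ)
  have hres : ∀ x, R x = T (x + (w - l ^ (α : ℂ)) • R x) := by
    intro x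
    rw [hRx]
    refine eqOn_halfPlane (f := H x) (g := fun z => T (x + (w - z ^ (α : ℂ)) • H x z))
      (hHd x) ?_ (fun m hm => ?_) hl
    · exact T.differentiable.comp_differentiableOn
        ((differentiableOn_const _).add (((differentiableOn_const _).sub (hpow _)).smul (hHd x)))
    · obtain ⟨Q, hQ, hQx⟩ := hreal m hm
      rw [← hQx]
      have h1 := hT.left ⟨Q x, hQ.mem x⟩
      have h2 := hQ.right x
      rw [sub_eq_iff_eq_add, ← sub_eq_iff_eq_add'] at h2
      rw [← h2] at h1
      refine h1.symm.trans (congrArg T ?_)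
      dsimp only
      module
  have hmem : ∀ x, R x ∈ A.domain := fun x => by rw [hres]; exact hT.mem _
  refine ⟨R, ⟨hmem, fun x => ?_, hleft⟩, LinearMap.mkContinuous_norm_le _ (by positivity) _⟩
  have h1 := hT.right (x + (w - l ^ (α : ℂ)) • R x)
  have h2 : (⟨_, hT.mem (x + (w - l ^ (α : ℂ)) • R x)⟩ : A.domain) = ⟨R x, hmem x⟩ :=
    Subtype.ext (hres x).symm
  rw [h2, ← hres] at h1
  linear_combination (norm := module) h1

/-- For `α > 2`, the powers `l ^ α` of points of a right half-plane fill a neighbourhood of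
infinity, on which the resolvent of `A` is `O(1/|z|)`. -/
theorem exists_resolvent_bound [CompleteSpace X] (hS : IsROF A α β S ω M) (hω : 0 ≤ ω)
    (hα : 2 < α) (hβ : 0 ≤ β) (hC : 0 ≤ C)
    (hbd : ∀ t : ℝ, 0 ≤ t → ‖S t‖ ≤ C * t ^ β * Real.exp (ω * t)) :
    ∃ r K : ℝ, ∀ z : ℂ, r < ‖z‖ → ∃ R : X →L[ℂ] X, IsResolventOf A z R ∧ ‖z‖ * ‖R‖ ≤ K := by
  have hα0 : 0 < α := by linarith
  have hπ := Real.pi_pos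
  set c := Real.cos (Real.pi / α) with hc
  have hπα : Real.pi / α < Real.pi / 2 := by gcongr
  have hc0 : 0 < c := Real.cos_pos_of_mem_Ioo ⟨by linarith [div_pos hπ hα0], hπα⟩
  refine ⟨(2 * ω / c) ^ α, C * ((2 / c) ^ (β + 1) * Real.Gamma (β + 1)), fun z hz => ?_⟩
  have hz0 : 0 < ‖z‖ := (Real.rpow_nonneg (by positivity) _).trans_lt hz
  have hzne : z ≠ 0 := norm_pos_iff.1 hz0
  set l : ℂ := z ^ ((α⁻¹ : ℝ) : ℂ) with hl
  have hln : ‖l‖ = ‖z‖ ^ α⁻¹ := Complex.norm_cpow_real _ _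
  have hl0 : 0 < ‖l‖ := by rw [hln]; positivity
  have hlα : ‖l‖ ^ α = ‖z‖ := by rw [hln, Real.rpow_inv_rpow hz0.le hα0.ne']
  have hlarge : 2 * ω / c < ‖l‖ := by
    rw [hln]
    exact (Real.lt_rpow_inv_iff_of_pos (by positivity) hz0.le hα0).2 hz
  have him : (Complex.log z * ((α⁻¹ : ℝ) : ℂ)).im = z.arg / α := by
    rw [Complex.im_mul_ofReal, Complex.log_im, div_eq_mul_inv]
  have hle : |z.arg / α| ≤ Real.pi / α := by
    rw [abs_div, abs_of_pos hα0]
    gcongr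
    exact Complex.abs_arg_le_pi z
  have hlt : Real.pi / α < Real.pi := by linarith
  have hpow : l ^ (α : ℂ) = z := by
    rw [hl, ← Complex.cpow_mul]
    · rw [← Complex.ofReal_mul, inv_mul_cancel₀ hα0.ne', Complex.ofReal_one, Complex.cpow_one]
    · rw [him]; linarith [(abs_le.1 hle).1]
    · rw [him]; linarith [(abs_le.1 hle).2]
  have hre : c * ‖l‖ ≤ l.re := by
    have h1 : l.re = ‖l‖ * Real.cos (z.arg / α) := by
      have : ‖l‖ = Real.exp (Complex.log z * ((α⁻¹ : ℝ) : ℂ)).re := by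
        rw [hl, Complex.cpow_def_of_ne_zero hzne, Complex.norm_exp]
      rw [this, ← him, ← Complex.exp_re, hl, Complex.cpow_def_of_ne_zero hzne]
    rw [h1, mul_comm, ← Real.cos_abs (z.arg / α)]
    gcongr
    exact Real.cos_le_cos_of_nonneg_of_le_pi (abs_nonneg _) hlt.le hle
  have hgap : c / 2 * ‖l‖ ≤ l.re - ω := by
    rw [div_lt_iff₀ hc0] at hlarge
    linarith
  have hgap0 : 0 < c / 2 * ‖l‖ := by positivity
  obtain ⟨R, hR, hRn⟩ := hS.exists_resolvent hω hβ hbd hC (l := l) (by linarith)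
  rw [hpow] at hR
  refine ⟨R, hR, ?_⟩
  have hgamma := Real.Gamma_pos_of_pos (show 0 < β + 1 by positivity)
  calc ‖z‖ * ‖R‖ ≤ ‖l‖ ^ α * (‖l‖ ^ (β + 1 - α) *
        (C * ((1 / (c / 2 * ‖l‖)) ^ (β + 1) * Real.Gamma (β + 1)))) := by
        rw [hlα]
        gcongr
        refine hRn.trans ?_
        have : 0 < l.re - ω := by linarith
        gcongr
    _ = (‖l‖ * (1 / (c / 2 * ‖l‖))) ^ (β + 1) * (C * Real.Gamma (β + 1)) := by
        rw [Real.mul_rpow hl0.le (by positivity), show β + 1 - α = (β + 1) - α by ring,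
          Real.rpow_sub hl0]
        field_simp
    _ = C * ((2 / c) ^ (β + 1) * Real.Gamma (β + 1)) := by
        rw [show ‖l‖ * (1 / (c / 2 * ‖l‖)) = 2 / c by field_simp]
        ring

end IsROF

theorem stmt9 {X : Type*} [NormedAddCommGroup X] [NormedSpace ℂ X]
    (A : X →ₗ.[ℂ] X) (alpha beta : ℝ) (halpha : 2 < alpha) (hbeta : 0 ≤ beta)
    (hdense : Dense (A.domain : Set X)) (hclosed : IsClosed (A.graph : Set (X × X)))
    (S : ℝ → X →L[ℂ] X) (omega M C : ℝ) (hC : 0 ≤ C) (homega : 0 ≤ omega)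
    (hS : IsROF A alpha beta S omega M)
    (hbd : ∀ t : ℝ, 0 ≤ t → ‖S t‖ ≤ C * t ^ beta * Real.exp (omega * t)) :
    A.domain = ⊤ ∧ ∃ C' : ℝ, ∀ x : A.domain, ‖A x‖ ≤ C' * ‖(x : X)‖ := by
  have := hS.completeSpace_s9 homega
  obtain ⟨r, K, h⟩ := hS.exists_resolvent_bound homega halpha hbeta hC hbd
  exact bounded_of_resolvent_bound hdense h
end
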